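/- arXiv:1306.0473 — 5 statements merged into one kernel-verified Lean document; each statement's English description precedes it below -/
import Mathlib

section
/- Let n and m be positive integers with 2n ≤ 2^m, and let P and Q be a pair of orthogonal partial latin squares of order n on the set of symbols [n] such that each symbol of [n] occurs in at most one cell of P. Then P and Q can be embedded in a pair of orthogonal latin squares 𝓐 and 𝓑 of order 2^{2m}; that is, there exist orthogonal latin squares L1, L2 of order 2^{2m} with P ⊆ L1 and Q ⊆ L2 (after identifying the rows, columns and symbols of P and Q with subsets of the rows, columns and symbols of L1 and L2 via fixed injections, the same row and column injections for both squares). -/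
/-- `P` is a partial latin square of order `n`: a set of (row, column, symbol) triples
from `[n] × [n] × [n]` such that any two triples agreeing in two coordinates agree in
the third. -/
def IsPLS (n : ℕ) (P : Set (ℕ × ℕ × ℕ)) : Prop :=
  (∀ t ∈ P, t.1 < n ∧ t.2.1 < n ∧ t.2.2 < n) ∧
  (∀ r c e e', (r, c, e) ∈ P → (r, c, e') ∈ P → e = e') ∧
  (∀ r c c' e, (r, c, e) ∈ P → (r, c', e) ∈ P → c = c') ∧
  (∀ r r' c e, (r, c, e) ∈ P → (r', c, e) ∈ P → r = r')

/-- `P` and `Q` are orthogonal partial latin squares: they have exactly the same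
non-empty cells, and whenever two distinct cells of `P` carry the same symbol the
corresponding cells of `Q` carry distinct symbols. -/
def OrthPLS (P Q : Set (ℕ × ℕ × ℕ)) : Prop :=
  (∀ r c, (∃ e, (r, c, e) ∈ P) ↔ (∃ e, (r, c, e) ∈ Q)) ∧
  (∀ r₁ c₁ r₂ c₂ x y₁ y₂, ((r₁, c₁) : ℕ × ℕ) ≠ (r₂, c₂) →
    (r₁, c₁, x) ∈ P → (r₂, c₂, x) ∈ P →
    (r₁, c₁, y₁) ∈ Q → (r₂, c₂, y₂) ∈ Q → y₁ ≠ y₂)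

/-- `L` is (the table of) a latin square of order `N` on rows, columns and symbols
`[N]`. -/
def IsLatin (N : ℕ) (L : ℕ → ℕ → ℕ) : Prop :=
  (∀ r c, r < N → c < N → L r c < N) ∧
  (∀ r c₁ c₂, r < N → c₁ < N → c₂ < N → L r c₁ = L r c₂ → c₁ = c₂) ∧
  (∀ r₁ r₂ c, r₁ < N → r₂ < N → c < N → L r₁ c = L r₂ c → r₁ = r₂)

/-- `L₁` and `L₂` are orthogonal latin squares of order `N`. -/
def OrthLatin (N : ℕ) (L₁ L₂ : ℕ → ℕ → ℕ) : Prop :=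
  ∀ r₁ c₁ r₂ c₂, r₁ < N → c₁ < N → r₂ < N → c₂ < N →
    ((r₁, c₁) : ℕ × ℕ) ≠ (r₂, c₂) → L₁ r₁ c₁ = L₁ r₂ c₂ → L₂ r₁ c₁ ≠ L₂ r₂ c₂

/-- The pair `(P, Q)` of partial latin squares of order `n` embeds in a pair of
orthogonal latin squares of order `N`: there are orthogonal latin squares `L₁, L₂` of
order `N` and a common injective relabeling `f` of rows and `g` of columns, and
injective relabelings `h₁, h₂` of symbols, mapping `P` into `L₁` and `Q` into `L₂`. -/
def EmbedsInOrthogonalPair (n N : ℕ) (P Q : Set (ℕ × ℕ × ℕ)) : Prop :=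
  ∃ L₁ L₂ : ℕ → ℕ → ℕ, ∃ f g h₁ h₂ : ℕ → ℕ,
    IsLatin N L₁ ∧ IsLatin N L₂ ∧ OrthLatin N L₁ L₂ ∧
    (∀ x, x < n → f x < N) ∧ (∀ x, x < n → g x < N) ∧
    (∀ x, x < n → h₁ x < N) ∧ (∀ x, x < n → h₂ x < N) ∧
    (∀ x y, x < n → y < n → f x = f y → x = y) ∧
    (∀ x y, x < n → y < n → g x = g y → x = y) ∧
    (∀ x y, x < n → y < n → h₁ x = h₁ y → x = y) ∧
    (∀ x y, x < n → y < n → h₂ x = h₂ y → x = y) ∧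
    (∀ r c e, (r, c, e) ∈ P → L₁ (f r) (g c) = h₁ e) ∧
    (∀ r c e, (r, c, e) ∈ Q → L₂ (f r) (g c) = h₂ e)

namespace EmbedAux

open Finset Classical

/-- Completing a partial injective map on `S` while avoiding a sparse relation. -/
theorem hall_sparse {α : Type} [Fintype α] (S : Finset α) (p : α → α)
    (hp : ∀ x ∈ S, ∀ y ∈ S, p x = p y → x = y) (forb : α → α → Prop) (k : ℕ)
    (hrow : ∀ c, (univ.filter (fun e => forb c e)).card ≤ k)
    (hcol : ∀ e, (univ.filter (fun c => forb c e)).card ≤ k)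
    (hk : S.card + 2 * k ≤ Fintype.card α) :
    ∃ s : α → α, Function.Injective s ∧ (∀ c ∈ S, s c = p c) ∧
      ∀ c, c ∉ S → ¬ forb c (s c) := by
  let N : {c : α // c ∉ S} → Finset α := fun c =>
    univ.filter (fun e => e ∉ S.image p ∧ ¬ forb c.1 e)
  have hN : ∀ c, Fintype.card α ≤ (N c).card + S.card + k := by
    intro c
    have h1 : (univ : Finset α) ⊆ N c ∪ S.image p ∪ univ.filter (fun e => forb c.1 e) := by
      intro e _
      simp only [mem_union, N, mem_filter, mem_univ, true_and]
      tauto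
    have h2 := card_le_card h1
    have h3 := card_union_le (N c ∪ S.image p) (univ.filter (fun e => forb c.1 e))
    have h4 := card_union_le (N c) (S.image p)
    have h5 : (S.image p).card ≤ S.card := card_image_le
    have h6 := hrow c.1
    rw [card_univ] at h2
    omega
  have hall : ∀ X : Finset {c : α // c ∉ S}, X.card ≤ (X.biUnion N).card := by
    intro X
    rcases X.eq_empty_or_nonempty with rfl | ⟨x0, hx0⟩
    · simp
    by_cases hy : ∃ y, y ∉ S.image p ∧ y ∉ X.biUnion N
    · obtain ⟨y, hy1, hy2⟩ := hy
      have hX : X.card ≤ k := by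
        rw [← card_map (Function.Embedding.subtype _)]
        refine le_trans (card_le_card ?_) (hcol y)
        intro c hc
        obtain ⟨d, hd, rfl⟩ := mem_map.1 hc
        simp only [mem_filter, mem_univ, true_and]
        by_contra hf
        apply hy2
        refine mem_biUnion.2 ⟨d, hd, ?_⟩
        simp only [N, mem_filter, mem_univ, true_and]
        exact ⟨hy1, hf⟩
      have h1 : (N x0).card ≤ (X.biUnion N).card := card_le_card (subset_biUnion_of_mem N hx0)
      have := hN x0
      omega
    · push Not at hy
      have h1 : (univ : Finset α) ⊆ X.biUnion N ∪ S.image p := by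
        intro e _
        by_cases he : e ∈ S.image p
        · exact mem_union_right _ he
        · exact mem_union_left _ (hy e he)
      have h2 := card_le_card h1
      have h3 := card_union_le (X.biUnion N) (S.image p)
      have h5 : (S.image p).card ≤ S.card := card_image_le
      have h6 : X.card + S.card ≤ Fintype.card α := by
        rw [← card_map (Function.Embedding.subtype _), ← card_union_of_disjoint]
        · exact card_le_univ _
        · rw [Finset.disjoint_left]
          intro c hc
          obtain ⟨d, hd, rfl⟩ := mem_map.1 hc
          exact d.2
      rw [card_univ] at h2
      omega
  obtain ⟨f, hf, hfN⟩ := (Finset.all_card_le_biUnion_card_iff_exists_injective N).1 hall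
  have hf' : ∀ c, f c ∉ S.image p ∧ ¬ forb c.1 (f c) := by
    intro c
    have := hfN c
    simpa only [N, mem_filter, mem_univ, true_and] using this
  refine ⟨fun c => if h : c ∈ S then p c else f ⟨c, h⟩, ?_, ?_, ?_⟩
  · intro x y hxy
    by_cases hx : x ∈ S <;> by_cases hy : y ∈ S
    · simp only [hx, hy, dif_pos] at hxy
      exact hp x hx y hy hxy
    · simp only [hx, hy, dif_pos, dif_neg, not_false_iff] at hxy
      exact absurd (hxy ▸ mem_image_of_mem p hx) (hf' ⟨y, hy⟩).1
    · simp only [hx, hy, dif_pos, dif_neg, not_false_iff] at hxy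
      exact absurd (hxy.symm ▸ mem_image_of_mem p hy) (hf' ⟨x, hx⟩).1
    · simp only [hx, hy, dif_neg, not_false_iff] at hxy
      simpa using hf hxy
  · intro c hc
    simp [hc]
  · intro c hc
    simp only [hc, dif_neg, not_false_iff]
    exact (hf' ⟨c, hc⟩).2

/-- State of the row by row completion: the rows in `A` are filled in. -/
structure Good {α : Type} (Q : α → α → α → Prop) (A : Finset α) (s : α → α → α) : Prop where
  inj : ∀ r ∈ A, Function.Injective (s r)
  col : ∀ r ∈ A, ∀ r' ∈ A, ∀ c, s r c = s r' c → r = r'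
  ext : ∀ r ∈ A, ∀ c e, Q r c e → s r c = e
  avoid : ∀ r ∈ A, ∀ r', r' ∉ A → ∀ c e, Q r' c e → s r c ≠ e

theorem Good.step {α : Type} {Q : α → α → α → Prop} {A : Finset α}
    {s : α → α → α} (h : Good Q A s) {r : α} (hr : r ∉ A) (t : α → α)
    (ht : Function.Injective t) (h1 : ∀ c e, Q r c e → t c = e)
    (h2 : ∀ a ∈ A, ∀ c, s a c ≠ t c)
    (h3 : ∀ r', r' ∉ A → r' ≠ r → ∀ c e, Q r' c e → t c ≠ e) :
    Good Q (insert r A) (Function.update s r t) := by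
  have hA : ∀ a ∈ A, Function.update s r t a = s a := by
    intro a ha
    have hne : a ≠ r := by
      rintro rfl
      exact hr ha
    exact Function.update_of_ne hne _ _
  constructor
  · intro x hx
    rcases mem_insert.1 hx with rfl | hx
    · simpa using ht
    · rw [hA x hx]; exact h.inj x hx
  · intro x hx y hy c hxy
    rcases mem_insert.1 hx with hxr | hx <;> rcases mem_insert.1 hy with hyr | hy
    · rw [hxr, hyr]
    · rw [hxr, hA y hy, Function.update_self] at hxy
      exact absurd hxy.symm (h2 y hy c)
    · rw [hyr, hA x hx, Function.update_self] at hxy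
      exact absurd hxy (h2 x hx c)
    · rw [hA x hx, hA y hy] at hxy
      exact h.col x hx y hy c hxy
  · intro x hx c e hQ
    rcases mem_insert.1 hx with rfl | hx
    · rw [Function.update_self]; exact h1 c e hQ
    · rw [hA x hx]; exact h.ext x hx c e hQ
  · intro x hx r' hr' c e hQ
    rw [mem_insert, not_or] at hr'
    rcases mem_insert.1 hx with rfl | hx
    · rw [Function.update_self]; exact h3 r' hr'.2 hr'.1 c e hQ
    · rw [hA x hx]; exact h.avoid x hx r' hr'.2 c e hQ

/-- Filling a row that contains prescribed entries. -/
theorem step_one {α : Type} [Fintype α] {Q : α → α → α → Prop}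
    (q1 : ∀ r c e e', Q r c e → Q r c e' → e = e')
    (q2 : ∀ r c c' e, Q r c e → Q r c' e → c = c')
    (q3 : ∀ r r' c e, Q r c e → Q r' c e → r = r')
    (R : Finset α) (hR : ∀ r c e, Q r c e → r ∈ R)
    {A : Finset α} (hAR : A ⊆ R) {s : α → α → α} (h : Good Q A s) {r : α} (hrR : r ∈ R)
    (hr : r ∉ A)
    (hk : (univ.filter (fun c => ∃ e, Q r c e)).card + 2 * (R.erase r).card ≤ Fintype.card α) :
    ∃ s', Good Q (insert r A) s' := by
  obtain ⟨S, hSdef⟩ : ∃ S, S = univ.filter (fun c => ∃ e, Q r c e) := ⟨_, rfl⟩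
  rw [← hSdef] at hk
  have hS : ∀ c, c ∈ S ↔ ∃ e, Q r c e := by intro c; simp [hSdef]
  have hex : ∃ p : α → α, ∀ c ∈ S, Q r c (p c) := by
    refine ⟨fun c => if hc : ∃ e, Q r c e then hc.choose else c, ?_⟩
    intro c hc
    have hc' := (hS c).1 hc
    simp only [hc', dif_pos]
    exact hc'.choose_spec
  obtain ⟨p, hpQ⟩ := hex
  obtain ⟨w, hw⟩ : ∃ w : α → α → α → Prop, ∀ b c e, w b c e ↔
      ((b ∈ A ∧ s b c = e) ∨ (b ∉ A ∧ Q b c e)) := ⟨_, fun _ _ _ => Iff.rfl⟩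
  obtain ⟨forb, hforb⟩ : ∃ forb : α → α → Prop, ∀ c e, forb c e ↔
      ∃ b ∈ R.erase r, w b c e := ⟨_, fun _ _ => Iff.rfl⟩
  have w1 : ∀ b c e e', w b c e → w b c e' → e = e' := by
    intro b c e e' hw1 hw2
    rw [hw] at hw1 hw2
    revert hw1 hw2
    rintro (⟨h1, h2⟩ | ⟨h1, h2⟩) (⟨h3, h4⟩ | ⟨h3, h4⟩)
    · exact h2.symm.trans h4
    · exact absurd h1 h3
    · exact absurd h3 h1
    · exact q1 _ _ _ _ h2 h4
  have w2 : ∀ b c c' e, w b c e → w b c' e → c = c' := by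
    intro b c c' e hw1 hw2
    rw [hw] at hw1 hw2
    revert hw1 hw2
    rintro (⟨h1, h2⟩ | ⟨h1, h2⟩) (⟨h3, h4⟩ | ⟨h3, h4⟩)
    · exact h.inj b h1 (h2.trans h4.symm)
    · exact absurd h1 h3
    · exact absurd h3 h1
    · exact q2 _ _ _ _ h2 h4
  have hrow : ∀ c, (univ.filter (fun e => forb c e)).card ≤ (R.erase r).card := by
    intro c
    refine card_le_card_of_forall_subsingleton (fun e b => w b c e) ?_ ?_
    · intro e he
      exact (hforb c e).1 (mem_filter.1 he).2
    · intro b _ e he e' he'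
      exact w1 _ _ _ _ he.2 he'.2
  have hcol : ∀ e, (univ.filter (fun c => forb c e)).card ≤ (R.erase r).card := by
    intro e
    refine card_le_card_of_forall_subsingleton (fun c b => w b c e) ?_ ?_
    · intro c hc
      exact (hforb c e).1 (mem_filter.1 hc).2
    · intro b _ c hc c' hc'
      exact w2 _ _ _ _ hc.2 hc'.2
  obtain ⟨t, ht, ht1, ht2⟩ := hall_sparse S p (by
      intro x hx y hy hxy
      have h1 := hpQ x hx
      rw [hxy] at h1
      exact q2 _ _ _ _ h1 (hpQ y hy)) forb _ hrow hcol hk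
  refine ⟨_, h.step hr t ht ?_ ?_ ?_⟩
  · intro c e hQ
    have hc := (hS c).2 ⟨e, hQ⟩
    rw [ht1 c hc]
    exact q1 _ _ _ _ (hpQ c hc) hQ
  · intro a ha c hac
    by_cases hc : c ∈ S
    · refine h.avoid a ha r hr c _ (hpQ c hc) ?_
      rw [hac, ht1 c hc]
    · have hne : a ≠ r := by
        rintro rfl
        exact hr ha
      exact ht2 c hc ((hforb _ _).2 ⟨a, mem_erase.2 ⟨hne, hAR ha⟩, (hw _ _ _).2 (Or.inl ⟨ha, hac⟩)⟩)
  · intro r' hr' hne c e hQ hte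
    by_cases hc : c ∈ S
    · have h1 := hpQ c hc
      rw [← ht1 c hc, hte] at h1
      exact hne (q3 _ _ _ _ hQ h1)
    · refine ht2 c hc ((hforb _ _).2
        ⟨r', mem_erase.2 ⟨hne, hR _ _ _ hQ⟩, (hw _ _ _).2 (Or.inr ⟨hr', ?_⟩)⟩)
      rw [hte]; exact hQ

/-- Filling a row when nothing remains prescribed. -/
theorem step_two {α : Type} [Fintype α] {Q : α → α → α → Prop}
    {A : Finset α} (hA : ∀ r c e, Q r c e → r ∈ A) {s : α → α → α} (h : Good Q A s) {r : α}
    (hr : r ∉ A) :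
    ∃ s', Good Q (insert r A) s' := by
  let N : α → Finset α := fun c => univ \ A.image (fun a => s a c)
  have hmem : ∀ c e, e ∈ N c ↔ ∀ a ∈ A, s a c ≠ e := by
    intro c e; simp [N]
  have hlt : A.card < Fintype.card α := by
    rw [← card_univ]
    exact card_lt_card ⟨subset_univ _, fun hh => hr (hh (mem_univ r))⟩
  have hNc : ∀ c, (N c).card = Fintype.card α - A.card := by
    intro c
    have : (A.image (fun a => s a c)).card = A.card :=
      card_image_of_injOn (fun a ha b hb hab => h.col a ha b hb c hab)
    simp only [N]
    rw [card_sdiff_of_subset (subset_univ _), this, card_univ]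
  have hNe : ∀ e, (univ.filter (fun c => e ∈ N c)).card ≤ Fintype.card α - A.card := by
    intro e
    have hbij : ∀ a ∈ A, ∃ c, s a c = e := fun a ha =>
      (Finite.surjective_of_injective (h.inj a ha)) e
    choose! g hg using hbij
    have h1 : (A.image g).card = A.card := by
      apply card_image_of_injOn
      intro a ha b hb hab
      refine h.col a ha b hb (g a) ?_
      rw [hg a ha]
      have : g a = g b := hab
      rw [this, hg b hb]
    have h2 : univ.filter (fun c => e ∈ N c) ⊆ univ \ A.image g := by
      intro c hc
      simp only [mem_filter, mem_univ, true_and, hmem] at hc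
      simp only [mem_sdiff, mem_univ, true_and, mem_image, not_exists, not_and]
      rintro a ha rfl
      exact hc a ha (hg a ha)
    refine (card_le_card h2).trans ?_
    rw [card_sdiff_of_subset (subset_univ _), h1, card_univ]
  have hall : ∀ X : Finset α, X.card ≤ (X.biUnion N).card := by
    intro X
    have := card_mul_le_card_mul (s := X) (t := X.biUnion N) (fun c e => e ∈ N c)
      (m := Fintype.card α - A.card) (n := Fintype.card α - A.card) (by
        intro c hc
        rw [← hNc c]
        apply card_le_card
        intro e he
        simp only [bipartiteAbove, mem_filter]
        exact ⟨mem_biUnion.2 ⟨c, hc, he⟩, he⟩) (by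
        intro e _
        refine le_trans (card_le_card ?_) (hNe e)
        intro c hc
        simp only [bipartiteBelow, mem_filter] at hc
        simp [hc.2])
    exact Nat.le_of_mul_le_mul_right this (by omega)
  obtain ⟨t, ht, htN⟩ := (Finset.all_card_le_biUnion_card_iff_exists_injective N).1 hall
  refine ⟨_, h.step hr t ht ?_ ?_ ?_⟩
  · intro c e hQ
    exact absurd (hA _ _ _ hQ) hr
  · intro a ha c
    exact (hmem c _).1 (htN c) a ha
  · intro r' hr' _ c e hQ
    exact (hr' (hA _ _ _ hQ)).elim

/-- Completion of a sparse partial latin square. -/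
theorem complete {α : Type} [Fintype α] {Q : α → α → α → Prop}
    (q1 : ∀ r c e e', Q r c e → Q r c e' → e = e')
    (q2 : ∀ r c c' e, Q r c e → Q r c' e → c = c')
    (q3 : ∀ r r' c e, Q r c e → Q r' c e → r = r')
    (hk : ∀ r, (univ.filter (fun c => ∃ e, Q r c e)).card +
      2 * ((univ.filter (fun r => ∃ c e, Q r c e)).erase r).card ≤ Fintype.card α) :
    ∃ B : α → α → α, (∀ r, Function.Injective (B r)) ∧
      (∀ c, Function.Injective (fun r => B r c)) ∧ ∀ r c e, Q r c e → B r c = e := by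
  set R := univ.filter (fun r => ∃ c e, Q r c e) with hRdef
  have hR : ∀ r c e, Q r c e → r ∈ R := by
    intro r c e hQ
    simp only [hRdef, mem_filter, mem_univ, true_and]
    exact ⟨c, e, hQ⟩
  have ph1 : ∀ A : Finset α, A ⊆ R → ∃ s, Good Q A s := by
    intro A
    induction A using Finset.induction_on with
    | empty => 
      intro _
      exact ⟨fun _ c => c, ⟨by simp, by simp, by simp, by simp⟩⟩
    | insert r A hr ih =>
      intro hA
      rw [insert_subset_iff] at hA
      obtain ⟨s, hs⟩ := ih hA.2
      exact step_one q1 q2 q3 R hR hA.2 hs hA.1 hr (hk r)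
  have ph2 : ∀ A : Finset α, ∃ s, Good Q (A ∪ R) s := by
    intro A
    induction A using Finset.induction_on with
    | empty => simpa using ph1 R (Subset.refl _)
    | insert r A hr ih =>
      obtain ⟨s, hs⟩ := ih
      rw [insert_union]
      by_cases hrA : r ∈ A ∪ R
      · rw [insert_eq_of_mem hrA]; exact ⟨s, hs⟩
      · exact step_two (fun r c e hQ => mem_union_right _ (hR r c e hQ)) hs hrA
  obtain ⟨s, hs⟩ := ph2 univ
  have hu : ∀ r, r ∈ (univ ∪ R : Finset α) := fun r => mem_union_left _ (mem_univ r)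
  exact ⟨s, fun r => hs.inj r (hu r), fun c r r' hrr => hs.col r (hu r) r' (hu r') c hrr,
    fun r c e hQ => hs.ext r (hu r) c e hQ⟩

/-- The counting estimate: the cells of `P` are at most `n` in number. -/
theorem count {n q : ℕ} (hnq : 2 * n ≤ q) (P : Set (ℕ × ℕ × ℕ)) (hP : IsPLS n P)
    (hPonce : ∀ r c r' c' x, (r, c, x) ∈ P → (r', c', x) ∈ P → r = r' ∧ c = c') (r : Fin q)
    (S R : Finset (Fin q)) (hS : ∀ c ∈ S, ∃ e, (r.1, c.1, e) ∈ P)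
    (hR : ∀ r' ∈ R, ∃ c e, (r'.1, c, e) ∈ P) :
    S.card + 2 * (R.erase r).card ≤ q := by
  choose! f hf using hS
  choose! g k hk using hR
  have hd : Disjoint (S.image f) ((R.erase r).image k) := by
    rw [Finset.disjoint_left]
    intro e he he'
    obtain ⟨c, hc, rfl⟩ := mem_image.1 he
    obtain ⟨r', hr', h⟩ := mem_image.1 he'
    have h1 := hk r' (mem_of_mem_erase hr')
    rw [h] at h1
    have := (hPonce _ _ _ _ _ h1 (hf c hc)).1
    exact (mem_erase.1 hr').1 (Fin.ext this)
  have h1 : (S.image f).card = S.card := by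
    apply card_image_of_injOn
    intro c hc c' hc' h
    have h2 := hf c hc
    have h : f c = f c' := h
    rw [h] at h2
    exact Fin.ext (hPonce _ _ _ _ _ h2 (hf c' hc')).2
  have h2 : ((R.erase r).image k).card = (R.erase r).card := by
    apply card_image_of_injOn
    intro c hc c' hc' h
    have h2 := hk c (mem_of_mem_erase hc)
    have h : k c = k c' := h
    rw [h] at h2
    exact Fin.ext (hPonce _ _ _ _ _ h2 (hk c' (mem_of_mem_erase hc'))).1
  have h3 : S.image f ∪ (R.erase r).image k ⊆ range n := by
    intro e he
    rw [mem_range]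
    rcases mem_union.1 he with he | he
    · obtain ⟨c, hc, rfl⟩ := mem_image.1 he
      exact (hP.1 _ (hf c hc)).2.2
    · obtain ⟨c, hc, rfl⟩ := mem_image.1 he
      exact (hP.1 _ (hk c (mem_of_mem_erase hc))).2.2
  have h4 := card_le_card h3
  rw [card_union_of_disjoint hd, h1, h2, card_range] at h4
  omega

/-- Transport of a latin square on a type with `N` elements to `ℕ`. -/
noncomputable def table {β : Type} {N : ℕ} (E : β ≃ Fin N) (L : β → β → β) (r c : ℕ) : ℕ :=
  if h : r < N ∧ c < N then (E (L (E.symm ⟨r, h.1⟩) (E.symm ⟨c, h.2⟩))).1 else 0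

theorem table_eq {β : Type} {N : ℕ} (E : β ≃ Fin N) (L : β → β → β) (r c : ℕ) (hr : r < N)
    (hc : c < N) : table E L r c = (E (L (E.symm ⟨r, hr⟩) (E.symm ⟨c, hc⟩))).1 := by
  simp [table, hr, hc]

theorem table_apply {β : Type} {N : ℕ} (E : β ≃ Fin N) (L : β → β → β) (x y : β) :
    table E L (E x).1 (E y).1 = (E (L x y)).1 := by
  rw [table_eq E L _ _ (E x).2 (E y).2]
  simp

theorem table_latin {β : Type} {N : ℕ} (E : β ≃ Fin N) (L : β → β → β)
    (h1 : ∀ r c c', L r c = L r c' → c = c') (h2 : ∀ r r' c, L r c = L r' c → r = r') :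
    IsLatin N (table E L) := by
  refine ⟨?_, ?_, ?_⟩
  · intro r c hr hc
    rw [table_eq E L _ _ hr hc]
    exact Fin.is_lt _
  · intro r c c' hr hc hc' h
    rw [table_eq E L _ _ hr hc, table_eq E L _ _ hr hc'] at h
    have := E.symm.injective (h1 _ _ _ (E.injective (Fin.ext h)))
    simpa using this
  · intro r r' c hr hr' hc h
    rw [table_eq E L _ _ hr hc, table_eq E L _ _ hr' hc] at h
    have := E.symm.injective (h2 _ _ _ (E.injective (Fin.ext h)))
    simpa using this

theorem table_orth {β : Type} {N : ℕ} (E : β ≃ Fin N) (L M : β → β → β)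
    (h : ∀ r c r' c', L r c = L r' c' → M r c = M r' c' → r = r' ∧ c = c') :
    OrthLatin N (table E L) (table E M) := by
  intro r c r' c' hr hc hr' hc' hne hL hM
  rw [table_eq E _ _ _ hr hc, table_eq E _ _ _ hr' hc'] at hL hM
  obtain ⟨ha, hb⟩ := h _ _ _ _ (E.injective (Fin.ext hL)) (E.injective (Fin.ext hM))
  have ha := E.symm.injective ha
  have hb := E.symm.injective hb
  simp only [Fin.mk.injEq] at ha hb
  exact hne (by rw [ha, hb])

end EmbedAux

/-- A pair of orthogonal partial latin squares of order `n`, where `2n ≤ 2^m` and each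
symbol occurs in at most one cell of `P`, embeds in a pair of orthogonal latin squares
of order `2^(2m)`. -/
theorem embed_no_repeated_symbols (n m : ℕ) (hn : 0 < n) (hm : 0 < m)
    (hnm : 2 * n ≤ 2 ^ m) (P Q : Set (ℕ × ℕ × ℕ))
    (hP : IsPLS n P) (hQ : IsPLS n Q) (hPQ : OrthPLS P Q)
    (hPonce : ∀ r c r' c' x, (r, c, x) ∈ P → (r', c', x) ∈ P → r = r' ∧ c = c') :
    EmbedsInOrthogonalPair n (2 ^ (2 * m)) P Q := by
  classical
  have hN : 2 ^ (2 * m) = 2 ^ m * 2 ^ m := by rw [two_mul, pow_add]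
  rw [hN]
  generalize hq : 2 ^ m = q at *
  have hq0 : 0 < q := by omega
  have : NeZero q := ⟨hq0.ne'⟩
  have cellQ : ∀ r c e, (r, c, e) ∈ Q → ∃ x, (r, c, x) ∈ P :=
    fun r c e h => (hPQ.1 r c).2 ⟨e, h⟩
  obtain ⟨B, hB1, hB2, hB3⟩ := EmbedAux.complete (α := Fin q)
    (Q := fun r c e => (r.1, c.1, e.1) ∈ Q)
    (fun r c e e' h h' => Fin.ext (hQ.2.1 _ _ _ _ h h'))
    (fun r c e e' h h' => Fin.ext (hQ.2.2.1 _ _ _ _ h h'))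
    (fun r c e e' h h' => Fin.ext (hQ.2.2.2 _ _ _ _ h h'))
    (by
      intro r
      rw [Fintype.card_fin]
      have key := EmbedAux.count hnm P hP hPonce r
        (Finset.univ.filter (fun c : Fin q => ∃ e : Fin q, (r.1, c.1, e.1) ∈ Q))
        (Finset.univ.filter (fun r : Fin q => ∃ c e : Fin q, (r.1, c.1, e.1) ∈ Q)) ?_ ?_
      · convert key
      · intro c hc
        simp only [Finset.mem_filter, Finset.mem_univ, true_and] at hc
        obtain ⟨e, he⟩ := hc
        exact cellQ _ _ _ he
      · intro r' hr'
        simp only [Finset.mem_filter, Finset.mem_univ, true_and] at hr'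
        obtain ⟨c, e, he⟩ := hr'
        exact ⟨c.1, cellQ _ _ _ he⟩)
  let E : Fin q × Fin q ≃ Fin (q * q) := finProdFinEquiv
  let L1 : Fin q × Fin q → Fin q × Fin q → Fin q × Fin q :=
    fun x y => (x.1 + (x.2 + y.2), x.2 + y.1)
  let L2 : Fin q × Fin q → Fin q × Fin q → Fin q × Fin q :=
    fun x y => (B x.1 y.1, x.2 + y.2)
  let ι : ℕ → Fin q := fun x => Fin.ofNat q x
  have ι_val : ∀ x, x < q → (ι x).1 = x := fun x hx => Nat.mod_eq_of_lt hx
  have ι_inj : ∀ x y, x < q → y < q → ι x = ι y → x = y := by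
    intro x y hx hy h
    rw [← ι_val x hx, ← ι_val y hy, h]
  let h₁ : ℕ → Fin q × Fin q := fun e =>
    if h : ∃ rc : ℕ × ℕ, (rc.1, rc.2, e) ∈ P then (ι h.choose.1, ι h.choose.2) else (ι e, ι n)
  have h₁P : ∀ r c e, (r, c, e) ∈ P → h₁ e = (ι r, ι c) := by
    intro r c e he
    have h : ∃ rc : ℕ × ℕ, (rc.1, rc.2, e) ∈ P := ⟨(r, c), he⟩
    obtain ⟨ha, hb⟩ := hPonce _ _ _ _ _ h.choose_spec he
    simp only [h₁, dif_pos h, ha, hb]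
  have h₁N : ∀ e, (¬ ∃ rc : ℕ × ℕ, (rc.1, rc.2, e) ∈ P) → h₁ e = (ι e, ι n) := by
    intro e he
    simp only [h₁, dif_neg he]
  refine ⟨EmbedAux.table E L1, EmbedAux.table E L2, fun x => (E (ι x, 0)).1, fun x => (E (ι x, 0)).1,
    fun x => (E (h₁ x)).1, fun x => (E (ι x, 0)).1, ?_, ?_, ?_, fun x _ => Fin.is_lt _,
    fun x _ => Fin.is_lt _, fun x _ => Fin.is_lt _, fun x _ => Fin.is_lt _, ?_, ?_, ?_, ?_, ?_, ?_⟩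
  · apply EmbedAux.table_latin
    · rintro ⟨a, b⟩ ⟨c, d⟩ ⟨c', d'⟩ h
      simp only [L1, Prod.mk.injEq, add_right_inj] at h
      rw [h.1, h.2]
    · rintro ⟨a, b⟩ ⟨a', b'⟩ ⟨c, d⟩ h
      simp only [L1, Prod.mk.injEq, add_left_inj] at h
      obtain ⟨h1, rfl⟩ := h
      rw [add_left_inj] at h1
      rw [h1]
  · apply EmbedAux.table_latin
    · rintro ⟨a, b⟩ ⟨c, d⟩ ⟨c', d'⟩ h
      simp only [L2, Prod.mk.injEq, add_right_inj] at h
      rw [hB1 a h.1, h.2]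
    · rintro ⟨a, b⟩ ⟨a', b'⟩ ⟨c, d⟩ h
      simp only [L2, Prod.mk.injEq, add_left_inj] at h
      rw [hB2 c h.1, h.2]
  · apply EmbedAux.table_orth
    rintro ⟨a, b⟩ ⟨c, d⟩ ⟨a', b'⟩ ⟨c', d'⟩ h h'
    simp only [L1, L2, Prod.mk.injEq] at h h'
    obtain ⟨h1, h2⟩ := h
    obtain ⟨h3, h4⟩ := h'
    rw [h4, add_left_inj] at h1
    subst h1
    have h5 := hB1 a h3
    subst h5
    rw [add_left_inj] at h2
    subst h2
    rw [add_right_inj] at h4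
    subst h4
    exact ⟨rfl, rfl⟩
  · intro x y hx hy h
    have := E.injective (Fin.ext h)
    simp only [Prod.mk.injEq, and_true] at this
    exact ι_inj x y (by omega) (by omega) this
  · intro x y hx hy h
    have := E.injective (Fin.ext h)
    simp only [Prod.mk.injEq, and_true] at this
    exact ι_inj x y (by omega) (by omega) this
  · intro x y hx hy h
    have h := E.injective (Fin.ext h)
    by_cases hx' : ∃ rc : ℕ × ℕ, (rc.1, rc.2, x) ∈ P <;>
      by_cases hy' : ∃ rc : ℕ × ℕ, (rc.1, rc.2, y) ∈ P
    · obtain ⟨⟨r, c⟩, hx'⟩ := hx'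
      obtain ⟨⟨r', c'⟩, hy'⟩ := hy'
      rw [h₁P _ _ _ hx', h₁P _ _ _ hy', Prod.mk.injEq] at h
      have b1 := hP.1 _ hx'
      have b2 := hP.1 _ hy'
      simp only at b1 b2 hx' hy'
      have e1 := ι_inj r r' (by omega) (by omega) h.1
      have e2 := ι_inj c c' (by omega) (by omega) h.2
      subst e1 e2
      exact hP.2.1 _ _ _ _ hx' hy'
    · obtain ⟨⟨r, c⟩, hx'⟩ := hx'
      rw [h₁P _ _ _ hx', h₁N _ hy', Prod.mk.injEq] at h
      have b1 := hP.1 _ hx'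
      simp only at b1
      have e2 := ι_inj c n (by omega) (by omega) h.2
      omega
    · obtain ⟨⟨r, c⟩, hy'⟩ := hy'
      rw [h₁P _ _ _ hy', h₁N _ hx', Prod.mk.injEq] at h
      have b1 := hP.1 _ hy'
      simp only at b1
      have e2 := ι_inj n c (by omega) (by omega) h.2
      omega
    · rw [h₁N _ hx', h₁N _ hy', Prod.mk.injEq] at h
      exact ι_inj x y (by omega) (by omega) h.1
  · intro x y hx hy h
    have := E.injective (Fin.ext h)
    simp only [Prod.mk.injEq, and_true] at this
    exact ι_inj x y (by omega) (by omega) this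
  · intro r c e he
    rw [EmbedAux.table_apply]
    beta_reduce
    rw [h₁P _ _ _ he]
    simp [L1]
  · intro r c e he
    rw [EmbedAux.table_apply]
    have b1 := hQ.1 _ he
    simp only at b1
    have : B (ι r) (ι c) = ι e := by
      apply hB3
      rw [ι_val r (by omega), ι_val c (by omega), ι_val e (by omega)]
      exact he
    simp [L2, this]
end

section
/- Let m be a positive integer, let ⋆ be bitwise addition modulo 2 (XOR) on [2^m], let A be a 2^m × 2^m array in which each symbol of [2^{2m}] occurs in exactly one cell (write r*c for its entry in cell (r,c)), and let B be a latin square of order 2^m on [2^m] with quasigroup operation ∘. For a,b,u,w ∈ [2^m] with a ≠ u, b ≠ w, a∘b ≠ u∘w and a⋆u ≠ b⋆w, define I_A(a,b;u,w) as the set of eight triples: with s = (a∘b)⋆(u∘w), I_A(a,b;u,w) = {((0,u),(0,w),u*w), ((0,u),(a⋆u, b),a*b), ((b⋆w, a),(0,w),a*b), ((b⋆w, a),(a⋆u, b),u*w), ((b⋆w⋆s, u⋆s),(a⋆u⋆s, w⋆s),a*b), ((b⋆w⋆s, u⋆s),(s, b⋆s),u*w), ((s, a⋆s),(a⋆u⋆s,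 w⋆s),u*w), ((s, a⋆s),(s, b⋆s),a*b)}. Suppose r1,r2,r3,c1,c2,c3 ∈ [2^m] satisfy: r1 < r2 < r3; c1,c2,c3 are pairwise distinct; r1∘c1, r2∘c2, r3∘c3 are pairwise distinct; and r_i⋆r_j ≠ c_i⋆c_k whenever i ≠ j, i ≠ k and i,j,k ∈ {1,2,3}. Then I_A(r1,c1;r2,c2) ∩ I_A(r1,c1;r3,c3) = ∅. -/
/-- `A` is a `2^m × 2^m` array in which each symbol of `[2^(2m)]` occurs in exactly one
cell. -/
def IsCellSymbolArray (m : ℕ) (A : ℕ → ℕ → ℕ) : Prop :=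
  (∀ r c, r < 2 ^ m → c < 2 ^ m → A r c < 2 ^ (2 * m)) ∧
  (∀ e, e < 2 ^ (2 * m) →
    ∃! rc : ℕ × ℕ, rc.1 < 2 ^ m ∧ rc.2 < 2 ^ m ∧ A rc.1 rc.2 = e)

/-- `B` is (the quasigroup operation of) a latin square of order `N` on `[N]`. -/
def IsLatinOp (N : ℕ) (B : ℕ → ℕ → ℕ) : Prop :=
  (∀ r c, r < N → c < N → B r c < N) ∧
  (∀ r c₁ c₂, r < N → c₁ < N → c₂ < N → B r c₁ = B r c₂ → c₁ = c₂) ∧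
  (∀ r₁ r₂ c, r₁ < N → r₂ < N → c < N → B r₁ c = B r₂ c → r₁ = r₂)

/-- The configuration `I_A(a,b;u,w)`: with `s = (a ∘ b) ⋆ (u ∘ w)`, the set of the
eight triples
`((0,u),(0,w),u*w)`, `((0,u),(a⋆u,b),a*b)`, `((b⋆w,a),(0,w),a*b)`,
`((b⋆w,a),(a⋆u,b),u*w)`, `((b⋆w⋆s,u⋆s),(a⋆u⋆s,w⋆s),a*b)`, `((b⋆w⋆s,u⋆s),(s,b⋆s),u*w)`,
`((s,a⋆s),(a⋆u⋆s,w⋆s),u*w)`, `((s,a⋆s),(s,b⋆s),a*b)`. -/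
def IAset (A B : ℕ → ℕ → ℕ) (a b u w : ℕ) : Set ((ℕ × ℕ) × (ℕ × ℕ) × ℕ) :=
  let s := B a b ^^^ B u w
  {((0, u), (0, w), A u w), ((0, u), (a ^^^ u, b), A a b),
   ((b ^^^ w, a), (0, w), A a b), ((b ^^^ w, a), (a ^^^ u, b), A u w),
   ((b ^^^ w ^^^ s, u ^^^ s), (a ^^^ u ^^^ s, w ^^^ s), A a b),
   ((b ^^^ w ^^^ s, u ^^^ s), (s, b ^^^ s), A u w),
   ((s, a ^^^ s), (a ^^^ u ^^^ s, w ^^^ s), A u w),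
   ((s, a ^^^ s), (s, b ^^^ s), A a b)}

/-- Distinct cells of the array contain distinct symbols. -/
theorem cell_ne {m : ℕ} {A : ℕ → ℕ → ℕ} (hA : IsCellSymbolArray m A) {r c r' c' : ℕ}
    (hr : r < 2 ^ m) (hc : c < 2 ^ m) (hr' : r' < 2 ^ m) (hc' : c' < 2 ^ m)
    (h : r ≠ r') : A r c ≠ A r' c' := by
  intro e
  obtain ⟨x, _, hx⟩ := hA.2 (A r c) (hA.1 r c hr hc)
  have h1 := hx (r, c) ⟨hr, hc, rfl⟩
  have h2 := hx (r', c') ⟨hr', hc', e.symm⟩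
  exact h (congrArg Prod.fst (h1.trans h2.symm))

/-- The pairwise coincidences of cells with the common symbol are impossible. -/
theorem cells_ne (a b u w s v x t : ℕ) (hau : a ≠ u) (hbw : b ≠ w) (hs : s ≠ 0)
    (hav : a ≠ v) (hbx : b ≠ x) (ht : t ≠ 0) (huv : u ≠ v) (hwx : w ≠ x) (hst : s ≠ t)
    (h1 : a ^^^ u ≠ b ^^^ w) (h2 : a ^^^ v ≠ b ^^^ x)
    (h3 : v ^^^ u ≠ x ^^^ b) (h4 : u ^^^ v ≠ w ^^^ b)
    (h5 : v ^^^ a ≠ x ^^^ w) (h6 : u ^^^ a ≠ w ^^^ x)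
    (h7 : u ^^^ v ≠ w ^^^ x)
    (p : (ℕ × ℕ) × (ℕ × ℕ))
    (hp : p = ((0, u), (a ^^^ u, b)) ∨ p = ((b ^^^ w, a), (0, w)) ∨
      p = ((b ^^^ w ^^^ s, u ^^^ s), (a ^^^ u ^^^ s, w ^^^ s)) ∨
      p = ((s, a ^^^ s), (s, b ^^^ s)))
    (hq : p = ((0, v), (a ^^^ v, b)) ∨ p = ((b ^^^ x, a), (0, x)) ∨
      p = ((b ^^^ x ^^^ t, v ^^^ t), (a ^^^ v ^^^ t, x ^^^ t)) ∨
      p = ((t, a ^^^ t), (t, b ^^^ t))) : False := by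
  have cancel : ∀ y z k : ℕ, y = z ^^^ k → z ^^^ y = k := by
    intro y z k h; rw [h, Nat.xor_xor_cancel_left]
  have key : ∀ y z y' z' k k' : ℕ, y ^^^ k = z ^^^ k' → y' ^^^ k = z' ^^^ k' →
      y ^^^ z = y' ^^^ z' := by
    intro y z y' z' k k' h h'
    have e1 : y ^^^ z = k ^^^ k' := by
      have : y = z ^^^ k' ^^^ k := by rw [← h, Nat.xor_xor_cancel_right]
      rw [this]; simp [Nat.xor_comm, Nat.xor_left_comm]
    have e2 : y' ^^^ z' = k ^^^ k' := by
      have : y' = z' ^^^ k' ^^^ k := by rw [← h', Nat.xor_xor_cancel_right]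
      rw [this]; simp [Nat.xor_comm, Nat.xor_left_comm]
    rw [e1, e2]
  rcases hp with rfl | rfl | rfl | rfl <;> rcases hq with h | h | h | h <;>
    simp only [Prod.mk.injEq] at h <;> obtain ⟨⟨e1, e2⟩, e3, e4⟩ := h
  · exact huv e2
  · exact hau e2.symm
  · exact h3 ((cancel _ _ _ e2).trans (cancel _ _ _ e4).symm)
  · exact ht e1.symm
  · exact hav e2
  · exact hwx e4
  · exact h5 ((cancel _ _ _ e2).trans (cancel _ _ _ e4).symm)
  · exact ht e3.symm
  · exact h4 ((cancel _ _ _ e2.symm).trans (cancel _ _ _ e4.symm).symm)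
  · exact h6 ((cancel _ _ _ e2.symm).trans (cancel _ _ _ e4.symm).symm)
  · exact h7 (key _ _ _ _ _ _ e2 e4)
  · have := key _ _ _ _ _ _ e2 e4
    exact h1 (by rw [Nat.xor_comm a, Nat.xor_comm b]; exact this)
  · exact hs e1
  · exact hs e3
  · exact h2 (key _ _ _ _ _ _ e2 e4)
  · exact hst e1

/-- Lemma 3.4: if `r₁ < r₂ < r₃`; `c₁, c₂, c₃` are pairwise distinct;
`r₁ ∘ c₁, r₂ ∘ c₂, r₃ ∘ c₃` are pairwise distinct; and `rᵢ ⋆ rⱼ ≠ cᵢ ⋆ c_k` whenever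
`i ≠ j`, `i ≠ k`, then `I_A(r₁,c₁;r₂,c₂) ∩ I_A(r₁,c₁;r₃,c₃) = ∅`. -/
theorem IA_disjoint (m : ℕ) (hm : 0 < m) (A B : ℕ → ℕ → ℕ)
    (hA : IsCellSymbolArray m A) (hB : IsLatinOp (2 ^ m) B)
    (r₁ r₂ r₃ c₁ c₂ c₃ : ℕ)
    (hr₁ : r₁ < 2 ^ m) (hr₂ : r₂ < 2 ^ m) (hr₃ : r₃ < 2 ^ m)
    (hc₁ : c₁ < 2 ^ m) (hc₂ : c₂ < 2 ^ m) (hc₃ : c₃ < 2 ^ m)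
    (hC1 : r₁ < r₂ ∧ r₂ < r₃)
    (hC2 : c₁ ≠ c₂ ∧ c₁ ≠ c₃ ∧ c₂ ≠ c₃)
    (hC3 : B r₁ c₁ ≠ B r₂ c₂ ∧ B r₁ c₁ ≠ B r₃ c₃ ∧ B r₂ c₂ ≠ B r₃ c₃)
    (hC4 : ∀ i j k : Fin 3, i ≠ j → i ≠ k →
      ![r₁, r₂, r₃] i ^^^ ![r₁, r₂, r₃] j ≠ ![c₁, c₂, c₃] i ^^^ ![c₁, c₂, c₃] k) :
    IAset A B r₁ c₁ r₂ c₂ ∩ IAset A B r₁ c₁ r₃ c₃ = ∅ := by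
  obtain ⟨hr12, hr23⟩ := hC1
  obtain ⟨hc12, hc13, hc23⟩ := hC2
  obtain ⟨hb12, hb13, hb23⟩ := hC3
  have A12 := cell_ne hA hr₁ hc₁ hr₂ hc₂ hr12.ne
  have A13 := cell_ne hA hr₁ hc₁ hr₃ hc₃ (hr12.trans hr23).ne
  have A23 := cell_ne hA hr₂ hc₂ hr₃ hc₃ hr23.ne
  rw [Set.eq_empty_iff_forall_notMem]
  rintro ⟨p1, p2, e⟩ ⟨hp, hq⟩
  simp only [IAset, Set.mem_insert_iff, Set.mem_singleton_iff, Prod.mk.injEq] at hp hq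
  have he : e = A r₁ c₁ := by grind
  subst he
  refine cells_ne r₁ c₁ r₂ c₂ (B r₁ c₁ ^^^ B r₂ c₂) r₃ c₃ (B r₁ c₁ ^^^ B r₃ c₃)
    hr12.ne hc12 ?_ (hr12.trans hr23).ne hc13 ?_ hr23.ne hc23 ?_
    (hC4 0 1 1 (by decide) (by decide)) (hC4 0 2 2 (by decide) (by decide))
    (hC4 2 1 0 (by decide) (by decide)) (hC4 1 2 0 (by decide) (by decide))
    (hC4 2 0 1 (by decide) (by decide)) (hC4 1 0 2 (by decide) (by decide))
    (hC4 1 2 2 (by decide) (by decide)) (p1, p2) ?_ ?_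
  · simpa [Nat.xor_eq_zero_iff] using hb12
  · simpa [Nat.xor_eq_zero_iff] using hb13
  · simpa using hb23
  · simp only [Prod.mk.injEq]
    simp only [A12, and_false, false_or, or_false, and_true] at hp
    simpa only [and_assoc] using hp
  · simp only [Prod.mk.injEq]
    simp only [A13, and_false, false_or, or_false, and_true] at hq
    simpa only [and_assoc] using hq
end

section
/- Let n and m be positive integers with 2n ≤ 2^m, and let P and Q be a pair of orthogonal partial latin squares of order n on the set of symbols [n]. Suppose that for every symbol x and all triples (r1,c1,x), (r2,c2,x), (r3,c3,x) ∈ P with (r1,c1) ≠ (r2,c2) and (r1,c1) ≠ (r3,c3) (the three triples need not be pairwise distinct), one has r1 XOR r2 ≠ c1 XOR c3, where XOR denotes bitwise addition modulo 2 on the nonnegative integers. Then P and Q can be embedded in a pair of orthogonal latin squares of order 2^{2m}; that is, there exist orthogonal latin squares L1, L2 of order 2^{2m} with P mapping into L1 and Q mapping into L2 under a common injective relabeling of rows and columns (and injective relabelings of symbols). -/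
/-- A `k`-regular bipartite graph with equal sides splits into `k` perfect matchings. -/
theorem regular_split {α β : Type*} [Fintype α] [Fintype β] [DecidableEq α] [DecidableEq β]
    (hcard : Fintype.card α = Fintype.card β) (k : ℕ) :
    ∀ t : α → Finset β, (∀ a, (t a).card = k) →
      (∀ b, (Finset.univ.filter (fun a => b ∈ t a)).card = k) →
      ∃ σ : Fin k → α → β, (∀ j, Function.Injective (σ j)) ∧ (∀ j a, σ j a ∈ t a) ∧
        ∀ a, Function.Injective (fun j => σ j a) := by
  induction k with
  | zero =>
    intro t _ _
    exact ⟨fun j => j.elim0, fun j => j.elim0, fun j => j.elim0, fun a j => j.elim0⟩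
  | succ k ih =>
    intro t ht1 ht2
    have hall : ∀ s : Finset α, s.card ≤ (s.biUnion t).card := by
      intro s
      have := Finset.card_mul_le_card_mul (s := s) (t := s.biUnion t) (fun a b => b ∈ t a)
        (m := k + 1) (n := k + 1) ?_ ?_
      · exact Nat.le_of_mul_le_mul_right this (Nat.succ_pos k)
      · intro a ha
        rw [← ht1 a]
        apply Finset.card_le_card
        intro b hb
        simp only [Finset.mem_bipartiteAbove, Finset.mem_biUnion]
        exact ⟨⟨a, ha, hb⟩, hb⟩
      · intro b _
        rw [← ht2 b]
        apply Finset.card_le_card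
        intro a ha
        simp only [Finset.mem_bipartiteBelow] at ha
        simp [ha.2]
    obtain ⟨f, hf, hft⟩ := (Finset.all_card_le_biUnion_card_iff_exists_injective t).1 hall
    have hfb : Function.Bijective f :=
      (Fintype.bijective_iff_injective_and_card f).2 ⟨hf, hcard⟩
    obtain ⟨σ, h1, h2, h3⟩ := ih (fun a => (t a).erase (f a))
      (fun a => by rw [Finset.card_erase_of_mem (hft a), ht1 a]; rfl)
      (fun b => by
        obtain ⟨a0, ha0⟩ := hfb.2 b
        have : (Finset.univ.filter (fun a => b ∈ (t a).erase (f a)))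
            = (Finset.univ.filter (fun a => b ∈ t a)).erase a0 := by
          ext a
          simp only [Finset.mem_filter, Finset.mem_univ, true_and, Finset.mem_erase]
          constructor
          · rintro ⟨h, h'⟩
            exact ⟨fun e => h (by rw [e, ha0]), h'⟩
          · rintro ⟨h, h'⟩
            exact ⟨fun e => h (hf (by rw [ha0, e])), h'⟩
        rw [this, Finset.card_erase_of_mem, ht2 b]
        · rfl
        · simp only [Finset.mem_filter, Finset.mem_univ, true_and]
          rw [← ha0]; exact hft a0)
    refine ⟨Fin.cons f σ, ?_, ?_, ?_⟩
    · intro j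
      refine Fin.cases ?_ (fun j => ?_) j
      · simpa using hf
      · simpa using h1 j
    · intro j a
      refine Fin.cases ?_ (fun j => ?_) j
      · simpa using hft a
      · simpa using Finset.mem_of_mem_erase (h2 j a)
    · intro a i j
      refine Fin.cases ?_ (fun i => ?_) i <;> refine Fin.cases ?_ (fun j => ?_) j
      · simp
      · intro h
        have := Finset.ne_of_mem_erase (h2 j a)
        simp at h
        exact absurd h.symm this
      · intro h
        have := Finset.ne_of_mem_erase (h2 i a)
        simp at h
        exact absurd h this
      · intro h
        simp only [Fin.cons_succ] at h
        exact congrArg Fin.succ (h3 a h)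

/-- Greedy filling of the `h × h` corner with `2h` symbols. -/
theorem greedy_fill {h : ℕ} {S : Type*} [Fintype S] [DecidableEq S]
    (hS : Fintype.card S = h + h) (D : Finset (Fin h × Fin h)) (F0 : Fin h × Fin h → S)
    (hrow : ∀ r c c', (r, c) ∈ D → (r, c') ∈ D → F0 (r, c) = F0 (r, c') → c = c')
    (hcol : ∀ r r' c, (r, c) ∈ D → (r', c) ∈ D → F0 (r, c) = F0 (r', c) → r = r') :
    ∃ F : Fin h × Fin h → S, (∀ a ∈ D, F a = F0 a) ∧
      (∀ r c c', F (r, c) = F (r, c') → c = c') ∧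
      (∀ r r' c, F (r, c) = F (r', c) → r = r') := by
  suffices H : ∀ E : Finset (Fin h × Fin h), ∃ F : Fin h × Fin h → S, (∀ a ∈ D, F a = F0 a) ∧
      (∀ r c c', (r, c) ∈ D ∪ E → (r, c') ∈ D ∪ E → F (r, c) = F (r, c') → c = c') ∧
      (∀ r r' c, (r, c) ∈ D ∪ E → (r', c) ∈ D ∪ E → F (r, c) = F (r', c) → r = r') by
    obtain ⟨F, h1, h2, h3⟩ := H Finset.univ
    exact ⟨F, h1, fun r c c' => h2 r c c' (by simp) (by simp),
      fun r r' c => h3 r r' c (by simp) (by simp)⟩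
  intro E
  induction E using Finset.induction_on with
  | empty => exact ⟨F0, fun _ _ => rfl, by simpa using hrow, by simpa using hcol⟩
  | insert a E _ ih =>
    obtain ⟨F, h1, h2, h3⟩ := ih
    by_cases haD : a ∈ D ∪ E
    · have : D ∪ insert a E = D ∪ E := by
        rw [Finset.union_insert, Finset.insert_eq_of_mem haD]
      rw [this]
      exact ⟨F, h1, h2, h3⟩
    · obtain ⟨r0, c0⟩ := a
      set B : Finset S := ((Finset.univ.erase c0).image fun c => F (r0, c)) ∪
        ((Finset.univ.erase r0).image fun r => F (r, c0)) with hB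
      have hBc : B.card < Fintype.card S := by
        have e1 : B.card ≤ (h - 1) + (h - 1) := by
          refine (Finset.card_union_le _ _).trans (Nat.add_le_add ?_ ?_)
          · refine Finset.card_image_le.trans ?_
            rw [Finset.card_erase_of_mem (Finset.mem_univ _)]; simp
          · refine Finset.card_image_le.trans ?_
            rw [Finset.card_erase_of_mem (Finset.mem_univ _)]; simp
        have := r0.pos
        omega
      obtain ⟨s, hs⟩ : ∃ s, s ∉ B := by
        by_contra hcon
        push Not at hcon
        have : B = Finset.univ := Finset.eq_univ_iff_forall.2 hcon
        rw [this, Finset.card_univ] at hBc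
        exact lt_irrefl _ hBc
      have hs1 : ∀ c, c ≠ c0 → F (r0, c) ≠ s := by
        intro c hc e
        apply hs
        rw [hB]
        apply Finset.mem_union_left
        exact Finset.mem_image.2 ⟨c, by simp [hc], e⟩
      have hs2 : ∀ r, r ≠ r0 → F (r, c0) ≠ s := by
        intro r hr e
        apply hs
        rw [hB]
        apply Finset.mem_union_right
        exact Finset.mem_image.2 ⟨r, by simp [hr], e⟩
      have hmem : ∀ b, b ≠ (r0, c0) → b ∈ D ∪ insert (r0, c0) E → b ∈ D ∪ E := by
        intro b hb hb'
        rw [Finset.union_insert] at hb'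
        exact Finset.mem_of_mem_insert_of_ne hb' hb
      refine ⟨Function.update F (r0, c0) s, ?_, ?_, ?_⟩
      · intro b hb
        rw [Function.update_of_ne, h1 b hb]
        rintro rfl
        exact haD (Finset.mem_union_left _ hb)
      · intro r c c' hm hm' e
        by_cases e1 : (r, c) = (r0, c0) <;> by_cases e2 : (r, c') = (r0, c0)
        · exact (Prod.mk.inj e1).2.trans (Prod.mk.inj e2).2.symm
        · rw [e1, Function.update_self, Function.update_of_ne e2] at e
          simp only [Prod.mk.injEq] at e1 e2
          obtain ⟨rfl, rfl⟩ := e1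
          exact absurd e.symm (hs1 c' (fun h => e2 ⟨rfl, h⟩))
        · rw [e2, Function.update_self, Function.update_of_ne e1] at e
          simp only [Prod.mk.injEq] at e1 e2
          obtain ⟨rfl, rfl⟩ := e2
          exact absurd e (hs1 c (fun h => e1 ⟨rfl, h⟩))
        · rw [Function.update_of_ne e1, Function.update_of_ne e2] at e
          exact h2 r c c' (hmem _ e1 hm) (hmem _ e2 hm') e
      · intro r r' c hm hm' e
        by_cases e1 : (r, c) = (r0, c0) <;> by_cases e2 : (r', c) = (r0, c0)
        · exact (Prod.mk.inj e1).1.trans (Prod.mk.inj e2).1.symm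
        · rw [e1, Function.update_self, Function.update_of_ne e2] at e
          simp only [Prod.mk.injEq] at e1 e2
          obtain ⟨rfl, rfl⟩ := e1
          exact absurd e.symm (hs2 r' (fun h => e2 ⟨h, rfl⟩))
        · rw [e2, Function.update_self, Function.update_of_ne e1] at e
          simp only [Prod.mk.injEq] at e1 e2
          obtain ⟨rfl, rfl⟩ := e2
          exact absurd e (hs2 r (fun h => e1 ⟨h, rfl⟩))
        · rw [Function.update_of_ne e1, Function.update_of_ne e2] at e
          exact h3 r r' c (hmem _ e1 hm) (hmem _ e2 hm') e

/-- An `h × h` array on `2h` symbols without repetitions in rows and columns is the corner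
of a latin square of order `2h`. -/
theorem corner_extend {h : ℕ} {S : Type*} [Fintype S] [DecidableEq S]
    (hS : Fintype.card S = h + h) (F : Fin h × Fin h → S)
    (hrow : ∀ r c c', F (r, c) = F (r, c') → c = c')
    (hcol : ∀ r r' c, F (r, c) = F (r', c) → r = r') :
    ∃ L : Fin h ⊕ Fin h → Fin h ⊕ Fin h → S,
      (∀ r, Function.Injective (L r)) ∧ (∀ c, Function.Injective (fun r => L r c)) ∧
      ∀ r c, L (Sum.inl r) (Sum.inl c) = F (r, c) := by
  have hJ : Fintype.card (Fin h ⊕ Fin h) = Fintype.card S := by simp [hS]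
  have hri : ∀ r, Function.Injective (fun c => F (r, c)) := fun r c c' e => hrow r c c' e
  have hci : ∀ c, Function.Injective (fun r => F (r, c)) := fun c r r' e => hcol r r' c e
  let t : Fin h ⊕ Fin h → Finset S := Sum.elim
    (fun r => (Finset.univ.image fun c => F (r, c))ᶜ) (fun c => Finset.univ.image fun r => F (r, c))
  obtain ⟨σ, s1, s2, s3⟩ := regular_split hJ h t
    (by
      rintro (r | c)
      · simp only [t, Sum.elim_inl, Finset.card_compl, hS,
          Finset.card_image_of_injective _ (hri r)]
        simp
      · simp only [t, Sum.elim_inr, Finset.card_image_of_injective _ (hci c)]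
        simp)
    (by
      intro s
      have key : (Finset.univ.filter (fun r => ∃ c, F (r, c) = s)).card
          = (Finset.univ.filter (fun c => ∃ r, F (r, c) = s)).card := by
        have a1 : (Finset.univ.filter (fun a => F a = s)).image Prod.fst
            = Finset.univ.filter (fun r => ∃ c, F (r, c) = s) := by
          ext r; simp
        have a2 : (Finset.univ.filter (fun a => F a = s)).image Prod.snd
            = Finset.univ.filter (fun c => ∃ r, F (r, c) = s) := by
          ext r; simp
        rw [← a1, ← a2, Finset.card_image_of_injOn, Finset.card_image_of_injOn]
        · rintro ⟨r, c⟩ ha ⟨r', c'⟩ hb (e : c = c')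
          simp at ha hb
          subst e
          rw [hcol r r' c (ha.trans hb.symm)]
        · rintro ⟨r, c⟩ ha ⟨r', c'⟩ hb (e : r = r')
          simp at ha hb
          subst e
          rw [hrow r c c' (ha.trans hb.symm)]
      have split : Finset.univ.filter (fun a => s ∈ t a)
          = (Finset.univ.filter (fun r => ∃ c, F (r, c) = s))ᶜ.disjSum
            (Finset.univ.filter (fun c => ∃ r, F (r, c) = s)) := by
        ext (r | c) <;> simp [t]
      rw [split, Finset.card_disjSum, Finset.card_compl, ← key]
      have := Finset.card_le_univ (Finset.univ.filter (fun r => ∃ c, F (r, c) = s))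
      simp only [Fintype.card_fin] at this ⊢
      omega)
  let M : Fin h → Fin h ⊕ Fin h → S := fun r => Sum.elim (fun c => F (r, c)) (fun j => σ j (Sum.inl r))
  have hdis : ∀ r c j, F (r, c) ≠ σ j (Sum.inl r) := by
    intro r c j e
    have := s2 j (Sum.inl r)
    simp [t] at this
    exact this c e
  have hM1 : ∀ r, Function.Injective (M r) := by
    intro r
    rintro (c | j) (c' | j') e
    · exact congrArg _ (hrow _ _ _ e)
    · exact absurd e (hdis r c j')
    · exact absurd e.symm (hdis r c' j)
    · exact congrArg _ (s3 (Sum.inl r) e)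
  have hM2 : ∀ c, Function.Injective (fun r => M r c) := by
    rintro (c | j) r r' e
    · exact hcol _ _ _ e
    · exact Sum.inl_injective (s1 j e)
  have hMb : ∀ r, Function.Bijective (M r) := fun r =>
    (Fintype.bijective_iff_injective_and_card _).2 ⟨hM1 r, hJ⟩
  obtain ⟨μ, m1, m2, m3⟩ := regular_split hJ h
    (fun c => (Finset.univ.image fun r => M r c)ᶜ)
    (by
      intro c
      rw [Finset.card_compl, hS, Finset.card_image_of_injective _ (hM2 c)]
      simp)
    (by
      intro s
      choose g hg using fun r => (hMb r).2 s
      have gi : Function.Injective g := by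
        intro r r' e
        apply hM2 (g r)
        simp only
        rw [hg r, e, hg r']
      have : Finset.univ.filter (fun c => s ∈ (Finset.univ.image fun r => M r c)ᶜ)
          = (Finset.univ.image g)ᶜ := by
        ext c
        simp only [Finset.mem_compl, Finset.mem_filter, Finset.mem_univ, true_and,
          Finset.mem_image, not_exists]
        constructor
        · intro H r e
          exact H r (by rw [← e, hg])
        · intro H r e
          exact H r (hM1 r (by rw [hg, e]))
      rw [this, Finset.card_compl, Finset.card_image_of_injective _ gi]
      simp)
  have hdis2 : ∀ r i c, M r c ≠ μ i c := by
    intro r i c e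
    have := m2 i c
    simp at this
    exact this r e
  refine ⟨Sum.elim M μ, ?_, ?_, fun r c => rfl⟩
  · rintro (r | i)
    · exact hM1 r
    · exact m1 i
  · intro c
    rintro (r | i) (r' | i') e
    · exact congrArg _ (hM2 c e)
    · exact absurd e (hdis2 r i' c)
    · exact absurd e.symm (hdis2 r' i c)
    · exact congrArg _ (m3 c e)

/-- Evans: a partial latin square of order `n ≤ h` embeds in a latin square of order `2h`. -/
theorem evans {n h : ℕ} (hnh : n ≤ h) (P : Set (ℕ × ℕ × ℕ)) (hP : IsPLS n P) :
    ∃ A : Fin (h + h) → Fin (h + h) → Fin (h + h),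
      (∀ r, Function.Injective (A r)) ∧ (∀ c, Function.Injective (fun r => A r c)) ∧
      ∀ r c e : Fin (h + h), (r.val, c.val, e.val) ∈ P → A r c = e := by
  classical
  obtain ⟨hb, hf, hr, hc⟩ := hP
  let D : Finset (Fin h × Fin h) := Finset.univ.filter
    (fun a => ∃ e : Fin (h + h), (a.1.val, a.2.val, e.val) ∈ P)
  let F0 : Fin h × Fin h → Fin (h + h) := fun a =>
    if H : ∃ e : Fin (h + h), (a.1.val, a.2.val, e.val) ∈ P then H.choose
    else ⟨a.1.val, by have := a.1.2; omega⟩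
  have hF0 : ∀ a ∈ D, (a.1.val, a.2.val, (F0 a).val) ∈ P := by
    intro a ha
    have H : ∃ e : Fin (h + h), (a.1.val, a.2.val, e.val) ∈ P := by simpa [D] using ha
    simp only [F0, dif_pos H]
    exact H.choose_spec
  obtain ⟨F, f1, f2, f3⟩ := greedy_fill (S := Fin (h + h)) (by simp) D F0
    (by
      intro r c c' h1 h2 e
      have k1 := hF0 _ h1
      have k2 := hF0 _ h2
      rw [← e] at k2
      exact Fin.ext (hr _ _ _ _ k1 k2))
    (by
      intro r r' c h1 h2 e
      have k1 := hF0 _ h1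
      have k2 := hF0 _ h2
      rw [← e] at k2
      exact Fin.ext (hc _ _ _ _ k1 k2))
  obtain ⟨L, l1, l2, l3⟩ := corner_extend (S := Fin (h + h)) (by simp) F f2 f3
  refine ⟨fun r c => L (finSumFinEquiv.symm r) (finSumFinEquiv.symm c), ?_, ?_, ?_⟩
  · intro r
    exact (l1 _).comp finSumFinEquiv.symm.injective
  · intro c
    exact (l2 (finSumFinEquiv.symm c)).comp finSumFinEquiv.symm.injective
  · intro r c e hm
    obtain ⟨b1, b2, b3⟩ := hb _ hm
    simp only at b1 b2 b3
    have er : r = Fin.castAdd h ⟨r.val, by omega⟩ := by ext; simp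
    have ec : c = Fin.castAdd h ⟨c.val, by omega⟩ := by ext; simp
    have hD : ((⟨r.val, by omega⟩, ⟨c.val, by omega⟩) : Fin h × Fin h) ∈ D := by
      simp only [D, Finset.mem_filter, Finset.mem_univ, true_and]
      exact ⟨e, hm⟩
    have := hF0 _ hD
    have h5 := hf _ _ _ _ this hm
    rw [er, ec]
    simp only [finSumFinEquiv_symm_apply_castAdd]
    rw [l3, f1 _ hD]
    exact Fin.ext h5

theorem main_construction {h n : ℕ} (hn : 0 < n) (hnh : n ≤ h) (P Q : Set (ℕ × ℕ × ℕ))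
    (hP : IsPLS n P) (hQ : IsPLS n Q) (hPQ : OrthPLS P Q) :
    EmbedsInOrthogonalPair n ((h + h) * (h + h)) P Q := by
  classical
  obtain ⟨A, A1, A2, A3⟩ := evans hnh P hP
  obtain ⟨B, B1, B2, B3⟩ := evans hnh Q hQ
  have : NeZero (h + h) := ⟨by omega⟩
  generalize hN : h + h = N at *
  have hnN : n ≤ N := by omega
  have hlam : ∀ x : Fin N, ∃ g : Fin N ≃ Fin N, ∀ r c : Fin N, (r.val, c.val, x.val) ∈ P →
      g (B r c) = c := by
    intro x
    let s : Finset (Fin N) := Finset.univ.filter (fun c => ∃ r : Fin N, (r.val, c.val, x.val) ∈ P)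
    let f : Fin N → Fin N := fun c =>
      if H : ∃ r : Fin N, (r.val, c.val, x.val) ∈ P then B H.choose c else c
    have hf : ∀ r c : Fin N, (r.val, c.val, x.val) ∈ P → f c = B r c := by
      intro r c hm
      have H : ∃ r : Fin N, (r.val, c.val, x.val) ∈ P := ⟨r, hm⟩
      simp only [f, dif_pos H]
      rw [Fin.ext (hP.2.2.2 _ _ _ _ H.choose_spec hm)]
    have hinj : Set.InjOn f s := by
      intro c hc c' hc' e
      obtain ⟨r, hr⟩ : ∃ r : Fin N, (r.val, c.val, x.val) ∈ P := by simpa [s] using hc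
      obtain ⟨r', hr'⟩ : ∃ r : Fin N, (r.val, c'.val, x.val) ∈ P := by simpa [s] using hc'
      rw [hf r c hr, hf r' c' hr'] at e
      by_contra hne
      obtain ⟨y, hy⟩ := (hPQ.1 r.val c.val).1 ⟨_, hr⟩
      obtain ⟨y', hy'⟩ := (hPQ.1 r'.val c'.val).1 ⟨_, hr'⟩
      have by1 := (hQ.1 _ hy).2.2
      have by2 := (hQ.1 _ hy').2.2
      simp only at by1 by2
      have e1 := B3 r c ⟨y, by omega⟩ hy
      have e2 := B3 r' c' ⟨y', by omega⟩ hy'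
      rw [e1, e2] at e
      refine hPQ.2 _ _ _ _ _ _ _ ?_ hr hr' hy hy' (Fin.mk.inj_iff.1 e)
      intro h
      exact hne (Fin.ext (Prod.mk.inj h).2)
    obtain ⟨g, hg⟩ := Finset.exists_equiv_extend_of_card_eq (t := (Finset.univ : Finset (Fin N)))
      (by simp) (Finset.subset_univ (s.image f)) hinj
    let g' : Fin N ≃ Fin N := g.trans (Equiv.subtypeUnivEquiv (by simp))
    refine ⟨g'.symm, ?_⟩
    intro r c hm
    rw [Equiv.symm_apply_eq, ← hf r c hm]
    have := hg c (by simp only [s, Finset.mem_filter, Finset.mem_univ, true_and]; exact ⟨r, hm⟩)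
    exact this.symm
  choose lam hl using hlam
  obtain ⟨enc, dec, e1, e2, e3⟩ : ∃ (enc : Fin N × Fin N → ℕ) (dec : ℕ → Fin N × Fin N),
      (∀ a, enc a < N * N) ∧ (∀ a, dec (enc a) = a) ∧ (∀ k, k < N * N → enc (dec k) = k) := by
    refine ⟨fun a => (finProdFinEquiv a).val,
      fun k => if H : k < N * N then finProdFinEquiv.symm ⟨k, H⟩ else (0, 0), ?_, ?_, ?_⟩
    · intro a; exact (finProdFinEquiv a).2
    · intro a
      have H := (finProdFinEquiv a).2
      simp only [dif_pos H]
      exact finProdFinEquiv.symm_apply_apply a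
    · intro k hk
      simp only [dif_pos hk]
      rw [Equiv.apply_symm_apply]
  have encinj : Function.Injective enc := fun a b e => by rw [← e2 a, e, e2]
  have decinj : ∀ k l, k < N * N → l < N * N → dec k = dec l → k = l := by
    intro k l hk hl e
    rw [← e3 k hk, e, e3 l hl]
  let of : ℕ → Fin N := fun k => Fin.ofNat N k
  have hof : ∀ k, k < n → (of k).val = k := fun k hk => Nat.mod_eq_of_lt (by omega)
  have ofinj : ∀ x y, x < n → y < n → of x = of y → x = y := by
    intro x y hx hy e
    rw [← hof x hx, e, hof y hy]
  let l1 : Fin N × Fin N → Fin N × Fin N → Fin N × Fin N := fun a b =>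
    (b.1 - b.2 + lam (A a.2 (b.2 + a.1)) (B a.2 b.2), A a.2 (b.2 + a.1))
  let l2 : Fin N × Fin N → Fin N × Fin N → Fin N × Fin N := fun a b =>
    (a.1 + b.1, B a.2 b.2)
  have l1r : ∀ a b b', l1 a b = l1 a b' → b = b' := by
    rintro ⟨p, r⟩ ⟨q, c⟩ ⟨q', c'⟩ e
    simp only [l1, Prod.mk.injEq] at e
    obtain ⟨h1, h2⟩ := e
    have hc : c = c' := add_right_cancel (A1 r h2)
    subst hc
    have := add_right_cancel h1
    rw [sub_left_inj] at this
    rw [this]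
  have l1c : ∀ a a' b, l1 a b = l1 a' b → a = a' := by
    rintro ⟨p, r⟩ ⟨p', r'⟩ ⟨q, c⟩ e
    simp only [l1, Prod.mk.injEq] at e
    obtain ⟨h1, h2⟩ := e
    rw [h2] at h1
    have h3 := (lam _).injective (add_left_cancel h1)
    have hr : r = r' := B2 c h3
    subst hr
    have := add_left_cancel (A1 r h2)
    rw [this]
  have l2r : ∀ a b b', l2 a b = l2 a b' → b = b' := by
    rintro ⟨p, r⟩ ⟨q, c⟩ ⟨q', c'⟩ e
    simp only [l2, Prod.mk.injEq] at e
    rw [add_left_cancel e.1, B1 r e.2]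
  have l2c : ∀ a a' b, l2 a b = l2 a' b → a = a' := by
    rintro ⟨p, r⟩ ⟨p', r'⟩ ⟨q, c⟩ e
    simp only [l2, Prod.mk.injEq] at e
    rw [add_right_cancel e.1, B2 c e.2]
  have lo : ∀ a b a' b', l1 a b = l1 a' b' → l2 a b = l2 a' b' → a = a' ∧ b = b' := by
    rintro ⟨p, r⟩ ⟨q, c⟩ ⟨p', r'⟩ ⟨q', c'⟩ e f
    simp only [l1, l2, Prod.mk.injEq] at e f
    obtain ⟨h1, h2⟩ := e
    obtain ⟨h3, h4⟩ := f
    rw [h2, h4] at h1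
    have h5 := add_right_cancel h1
    have h6 : c + p = c' + p' := by
      have i1 : c + p = (p + q) - (q - c) := by abel
      have i2 : c' + p' = (p' + q') - (q' - c') := by abel
      rw [i1, i2, h3, h5]
    rw [h6] at h2
    have hr : r = r' := A2 _ h2
    subst hr
    have hc : c = c' := B1 r h4
    subst hc
    have hp : p = p' := add_left_cancel h6
    subst hp
    have hq : q = q' := add_left_cancel h3
    subst hq
    exact ⟨rfl, rfl⟩
  refine ⟨fun a b => enc (l1 (dec a) (dec b)), fun a b => enc (l2 (dec a) (dec b)),
    fun k => enc (0, of k), fun k => enc (0, of k), fun k => enc (0, of k), fun k => enc (0, of k),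
    ⟨fun _ _ _ _ => e1 _, ?_, ?_⟩, ⟨fun _ _ _ _ => e1 _, ?_, ?_⟩, ?_,
    fun _ _ => e1 _, fun _ _ => e1 _, fun _ _ => e1 _, fun _ _ => e1 _, ?_, ?_, ?_, ?_, ?_, ?_⟩
  · intro r c c' _ h1 h2 e
    exact decinj _ _ h1 h2 (l1r _ _ _ (encinj e))
  · intro r c c' h1 h2 _ e
    exact decinj _ _ h1 h2 (l1c _ _ _ (encinj e))
  · intro r c c' _ h1 h2 e
    exact decinj _ _ h1 h2 (l2r _ _ _ (encinj e))
  · intro r c c' h1 h2 _ e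
    exact decinj _ _ h1 h2 (l2c _ _ _ (encinj e))
  · intro r c r' c' h1 h2 h3 h4 hne e f
    obtain ⟨k1, k2⟩ := lo _ _ _ _ (encinj e) (encinj f)
    exact hne (by rw [decinj _ _ h1 h3 k1, decinj _ _ h2 h4 k2])
  iterate 4
    · intro x y hx hy e
      exact ofinj x y hx hy (Prod.mk.inj (encinj e)).2
  · intro r c e hm
    obtain ⟨b1, b2, b3⟩ := hP.1 _ hm
    simp only at b1 b2 b3
    have hm' : ((of r).val, (of c).val, (of e).val) ∈ P := by
      rw [hof r b1, hof c b2, hof e b3]; exact hm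
    simp only [e2, l1, add_zero, zero_sub]
    rw [A3 _ _ _ hm', hl _ _ _ hm']
    simp
  · intro r c e hm
    obtain ⟨b1, b2, b3⟩ := hQ.1 _ hm
    simp only at b1 b2 b3
    have hm' : ((of r).val, (of c).val, (of e).val) ∈ Q := by
      rw [hof r b1, hof c b2, hof e b3]; exact hm
    simp only [e2, l2, add_zero]
    rw [B3 _ _ _ hm']

/-- Theorem 4.1 (conditional embedding): if `P` and `Q` are orthogonal partial latin
squares of order `n` with `2n ≤ 2^m`, and Condition C4 holds for all incidences of a
repeated symbol in `P` (for triples `(r₁,c₁,x), (r₂,c₂,x), (r₃,c₃,x) ∈ P` with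
`(r₁,c₁) ≠ (r₂,c₂)` and `(r₁,c₁) ≠ (r₃,c₃)` one has `r₁ XOR r₂ ≠ c₁ XOR c₃`), then
`P` and `Q` embed in a pair of orthogonal latin squares of order `2^(2m)`. -/
theorem conditional_embedding (n m : ℕ) (hn : 0 < n) (hm : 0 < m)
    (hnm : 2 * n ≤ 2 ^ m) (P Q : Set (ℕ × ℕ × ℕ))
    (hP : IsPLS n P) (hQ : IsPLS n Q) (hPQ : OrthPLS P Q)
    (hC4 : ∀ x r₁ c₁ r₂ c₂ r₃ c₃,
      (r₁, c₁, x) ∈ P → (r₂, c₂, x) ∈ P → (r₃, c₃, x) ∈ P →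
      ((r₁, c₁) : ℕ × ℕ) ≠ (r₂, c₂) → ((r₁, c₁) : ℕ × ℕ) ≠ (r₃, c₃) →
      r₁ ^^^ r₂ ≠ c₁ ^^^ c₃) :
    EmbedsInOrthogonalPair n (2 ^ (2 * m)) P Q := by
  obtain ⟨k, rfl⟩ : ∃ k, m = k + 1 := ⟨m - 1, by omega⟩
  have h1 : n ≤ 2 ^ k := by rw [pow_succ] at hnm; omega
  have h2 : 2 ^ (2 * (k + 1)) = (2 ^ k + 2 ^ k) * (2 ^ k + 2 ^ k) := by
    have : 2 ^ k + 2 ^ k = 2 ^ (k + 1) := by rw [pow_succ]; omega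
    rw [this, two_mul, pow_add]
  rw [h2]
  exact main_construction hn h1 P Q hP hQ hPQ
end

section
/- Let n and m be positive integers with n ≤ 2^m, and let P and Q be a pair of orthogonal partial latin squares of order n on the set of symbols [n]. Then P and Q can be embedded in a pair of orthogonal latin squares of order 2^{4m}; that is, there exist orthogonal latin squares L1, L2 of order 2^{4m} with P mapping into L1 and Q mapping into L2 under a common injective relabeling of rows and columns (and injective relabelings of symbols). -/
section Abstract

/-- Transfer from an arbitrary finite alphabet `A` of size `N` to `[N]`. -/
theorem embeds_of_type {A : Type*} [Fintype A] (n N : ℕ) (hN : Fintype.card A = N)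
    (P Q : Set (ℕ × ℕ × ℕ)) (M₁ M₂ : A → A → A) (f g h k : ℕ → A)
    (h1r : ∀ x y y', M₁ x y = M₁ x y' → y = y')
    (h1c : ∀ x x' y, M₁ x y = M₁ x' y → x = x')
    (h2r : ∀ x y y', M₂ x y = M₂ x y' → y = y')
    (h2c : ∀ x x' y, M₂ x y = M₂ x' y → x = x')
    (ho : ∀ x y x' y', M₁ x y = M₁ x' y' → M₂ x y = M₂ x' y' → x = x' ∧ y = y')
    (hf : ∀ x y, x < n → y < n → f x = f y → x = y)
    (hg : ∀ x y, x < n → y < n → g x = g y → x = y)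
    (hh : ∀ x y, x < n → y < n → h x = h y → x = y)
    (hk : ∀ x y, x < n → y < n → k x = k y → x = y)
    (hP : ∀ r c e, (r, c, e) ∈ P → M₁ (f r) (g c) = h e)
    (hQ : ∀ r c e, (r, c, e) ∈ Q → M₂ (f r) (g c) = k e) :
    EmbedsInOrthogonalPair n N P Q := by
  classical
  have hne : Nonempty A := ⟨f 0⟩
  obtain ⟨enc, dec, henc, hde, hed⟩ : ∃ (enc : A → ℕ) (dec : ℕ → A), (∀ a, enc a < N) ∧
      (∀ a, dec (enc a) = a) ∧ (∀ x, x < N → enc (dec x) = x) := by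
    let e := Fintype.equivFinOfCardEq hN
    refine ⟨fun a => (e a : ℕ), fun x => if hx : x < N then e.symm ⟨x, hx⟩ else f 0, ?_, ?_, ?_⟩
    · intro a; exact (e a).2
    · intro a; simp
    · intro x hx; simp [hx]
  have hei : ∀ a b, enc a = enc b → a = b := fun a b hab => by rw [← hde a, ← hde b, hab]
  have hdi : ∀ x y, x < N → y < N → dec x = dec y → x = y := fun x y hx hy hxy => by
    rw [← hed x hx, ← hed y hy, hxy]
  refine ⟨fun r c => enc (M₁ (dec r) (dec c)), fun r c => enc (M₂ (dec r) (dec c)),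
    fun x => enc (f x), fun x => enc (g x), fun x => enc (h x), fun x => enc (k x),
    ⟨fun _ _ _ _ => henc _, ?_, ?_⟩, ⟨fun _ _ _ _ => henc _, ?_, ?_⟩, ?_,
    fun _ _ => henc _, fun _ _ => henc _, fun _ _ => henc _, fun _ _ => henc _,
    fun x y hx hy e => hf x y hx hy (hei _ _ e), fun x y hx hy e => hg x y hx hy (hei _ _ e),
    fun x y hx hy e => hh x y hx hy (hei _ _ e), fun x y hx hy e => hk x y hx hy (hei _ _ e),
    ?_, ?_⟩
  · intro r c c' _ hc hc' e
    exact hdi _ _ hc hc' (h1r _ _ _ (hei _ _ e))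
  · intro r r' c hr hr' _ e
    exact hdi _ _ hr hr' (h1c _ _ _ (hei _ _ e))
  · intro r c c' _ hc hc' e
    exact hdi _ _ hc hc' (h2r _ _ _ (hei _ _ e))
  · intro r r' c hr hr' _ e
    exact hdi _ _ hr hr' (h2c _ _ _ (hei _ _ e))
  · intro r c r' c' hr hc hr' hc' hne e1 e2
    obtain ⟨e3, e4⟩ := ho _ _ _ _ (hei _ _ e1) (hei _ _ e2)
    exact hne (by rw [hdi _ _ hr hr' e3, hdi _ _ hc hc' e4])
  · intro r c e he
    simp only [hde, hP r c e he]
  · intro r c e he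
    simp only [hde, hQ r c e he]

/-- The perturbed squares `x + y + D₃` and `x + α y + D₄` are orthogonal latin squares as soon as
the perturbations are invariant under suitable shifts by themselves. Here `ρ = α / (1 + α)` and
`β = 1 / α`. -/
theorem perturbed {F V : Type*} [Field F] [AddCommGroup V] [Module F V] (h2 : (2 : F) = 0)
    (α β ρ : F) (hα : α * (1 + ρ) = ρ) (hβ : α * β = 1)
    (D₃ D₄ : V → V → V)
    (a1 : ∀ x y, D₃ x (y + D₃ x y) = D₃ x y)
    (a2 : ∀ x y, D₃ (x + D₃ x y) y = D₃ x y)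
    (a3 : ∀ x y, D₃ (x + ρ • D₃ x y) (y + (1 + ρ) • D₃ x y) = D₃ x y)
    (b1 : ∀ x y, D₄ x (y + β • D₄ x y) = D₄ x y)
    (b2 : ∀ x y, D₄ (x + D₄ x y) y = D₄ x y)
    (b3 : ∀ x y, D₄ (x + (1 + ρ) • D₄ x y) (y + (1 + ρ) • D₄ x y) = D₄ x y)
    (c : ∀ x y, D₄ (x + ρ • D₃ x y) (y + (1 + ρ) • D₃ x y) = D₄ x y) :
    (∀ x y y', x + y + D₃ x y = x + y' + D₃ x y' → y = y') ∧
    (∀ x x' y, x + y + D₃ x y = x' + y + D₃ x' y → x = x') ∧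
    (∀ x y y', x + α • y + D₄ x y = x + α • y' + D₄ x y' → y = y') ∧
    (∀ x x' y, x + α • y + D₄ x y = x' + α • y + D₄ x' y → x = x') ∧
    (∀ x y x' y', x + y + D₃ x y = x' + y' + D₃ x' y' →
      x + α • y + D₄ x y = x' + α • y' + D₄ x' y' → x = x' ∧ y = y') := by
  have hα0 : α ≠ 0 := by rintro rfl; simp at hβ
  have hα1 : (1 + α) * (1 + ρ) = 1 := by linear_combination hα + ρ * h2
  have hlin : ∀ x y x' y' : V, x + y = x' + y' → x + α • y = x' + α • y' → x = x' ∧ y = y' := by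
    intro x y x' y' e1 e2
    have e3 : (1 - α) • (y - y') = 0 := by
      have : (1 - α) • (y - y') = ((x + y) - (x' + y')) - ((x + α • y) - (x' + α • y')) := by
        module
      rw [this, e1, e2]; simp
    have e4 : (1 - α) ≠ 0 := by
      intro h0
      have : (1 + α) = 0 := by linear_combination h0 + α * h2
      rw [this] at hα1; simp at hα1
    have e5 : y = y' := by
      rcases smul_eq_zero.1 e3 with h | h
      · exact absurd h e4
      · exact sub_eq_zero.1 h
    subst e5
    exact ⟨add_right_cancel e1, rfl⟩
  refine ⟨?_, ?_, ?_, ?_, ?_⟩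
  · intro x y y' e
    have e1 : y + D₃ x y = y' + D₃ x y' := by
      have := e; rw [add_assoc, add_assoc] at this; exact add_left_cancel this
    have e2 : D₃ x y = D₃ x y' := by rw [← a1 x y, e1, a1 x y']
    rw [e2] at e1; exact add_right_cancel e1
  · intro x x' y e
    have e1 : x + D₃ x y = x' + D₃ x' y := by
      have : x + D₃ x y + y = x' + D₃ x' y + y := by
        rw [add_right_comm, e, add_right_comm]
      exact add_right_cancel this
    have e2 : D₃ x y = D₃ x' y := by rw [← a2 x y, e1, a2 x' y]
    rw [e2] at e1; exact add_right_cancel e1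
  · intro x y y' e
    have e1 : y + β • D₄ x y = y' + β • D₄ x y' := by
      have h0 : α • y + D₄ x y = α • y' + D₄ x y' := by
        have := e; rw [add_assoc, add_assoc] at this; exact add_left_cancel this
      have hb : β * α = 1 := by rw [mul_comm]; exact hβ
      have := congrArg (fun v => β • v) h0
      simpa [smul_add, smul_smul, hb] using this
    have e2 : D₄ x y = D₄ x y' := by rw [← b1 x y, e1, b1 x y']
    rw [e2] at e1; exact add_right_cancel e1
  · intro x x' y e
    have e1 : x + D₄ x y = x' + D₄ x' y := by
      have : x + D₄ x y + α • y = x' + D₄ x' y + α • y := by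
        rw [add_right_comm, e, add_right_comm]
      exact add_right_cancel this
    have e2 : D₄ x y = D₄ x' y := by rw [← b2 x y, e1, b2 x' y]
    rw [e2] at e1; exact add_right_cancel e1
  · intro x y x' y' e1 e2
    have two : ∀ v : V, v + v = 0 := fun v => by
      have : v + v = (2 : F) • v := by module
      rw [this, h2, zero_smul]
    -- the two commuting involutions in coordinates
    have k1 : ∀ x y : V, (x + ρ • D₃ x y + (1 + ρ) • D₄ x y) + (y + (1 + ρ) • D₃ x y
        + (1 + ρ) • D₄ x y) = x + y + D₃ x y := by
      intro x y
      have : (x + ρ • D₃ x y + (1 + ρ) • D₄ x y) + (y + (1 + ρ) • D₃ x y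
        + (1 + ρ) • D₄ x y) = x + y + D₃ x y + (2 * ρ) • D₃ x y + (2 * (1 + ρ)) • D₄ x y := by
        module
      rw [this, h2]; simp
    have k2 : ∀ x y : V, (x + ρ • D₃ x y + (1 + ρ) • D₄ x y) + α • (y + (1 + ρ) • D₃ x y
        + (1 + ρ) • D₄ x y) = x + α • y + D₄ x y := by
      intro x y
      have : (x + ρ • D₃ x y + (1 + ρ) • D₄ x y) + α • (y + (1 + ρ) • D₃ x y
        + (1 + ρ) • D₄ x y) = x + α • y + (ρ + α * (1 + ρ)) • D₃ x y
          + ((1 + α) * (1 + ρ)) • D₄ x y := by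
        module
      rw [this, hα1, hα, ← two_mul, h2]; simp
    obtain ⟨e3, e4⟩ := hlin _ _ _ _ ((k1 x y).trans (e1.trans (k1 x' y').symm))
      ((k2 x y).trans (e2.trans (k2 x' y').symm))
    have d4 : D₄ x y = D₄ x' y' := by
      have q : ∀ x y, D₄ (x + ρ • D₃ x y + (1 + ρ) • D₄ x y)
          (y + (1 + ρ) • D₃ x y + (1 + ρ) • D₄ x y) = D₄ x y := by
        intro x y
        have := b3 (x + ρ • D₃ x y) (y + (1 + ρ) • D₃ x y)
        rw [c x y] at this
        exact this
      rw [← q x y, ← q x' y', e3, e4]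
    rw [d4] at e3 e4
    have e5 := add_right_cancel e3
    have e6 := add_right_cancel e4
    have d3 : D₃ x y = D₃ x' y' := by
      rw [← a3 x y, ← a3 x' y', e5, e6]
    rw [d3] at e5 e6
    exact ⟨add_right_cancel e5, add_right_cancel e6⟩

end Abstract
section Cells

variable {F : Type*} [Field F]

/-- cells of the first swap -/
def InS1 (ρ l m l' m' : F) : Prop :=
  m = 0 ∧ m' = 0 ∧ (l = 0 ∨ l = 1 ∨ l = ρ ∨ l = 1 + ρ) ∧ (l' = l ∨ l' = l + 1)

/-- cells of the second swap -/
def InS2 (β ρ l m l' m' : F) : Prop :=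
  ((l = 0 ∧ l' = 0) ∨ (l = ρ ∧ l' = 1 + ρ)) ∧ (m = 0 ∨ m = 1 ∨ m = ρ ∨ m = 1 + ρ) ∧
    (m' = β * m ∨ m' = β * (m + 1))

/-- at least two of four elements vanish -/
def TwoZero (A B C D : F) : Prop :=
  (A = 0 ∧ B = 0) ∨ (A = 0 ∧ C = 0) ∨ (A = 0 ∧ D = 0) ∨ (B = 0 ∧ C = 0) ∨ (B = 0 ∧ D = 0) ∨
    (C = 0 ∧ D = 0)

theorem key1 (h2 : (2 : F) = 0) (α ρ : F) (hα : α * (1 + ρ) = ρ) (hρ0 : ρ ≠ 0)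
    (hρ : 1 + ρ ≠ 0) (l m l' m' A B C D : F)
    (h : InS1 ρ l m l' m')
    (e1 : A + l * (A + C) + m * (A + D) = 0) (e2 : l * B + m * (α * B) = 0)
    (e3 : l' * (A + C) + m' * (A + D) = 0) (e4 : B + l' * B + m' * (α * B) = 0) :
    TwoZero A B C D := by
  obtain ⟨rfl, rfl, h1, h3⟩ := h
  unfold TwoZero
  rcases h1 with rfl | rfl | rfl | rfl <;> rcases h3 with rfl | rfl <;> grind

theorem key2 (h2 : (2 : F) = 0) (α β ρ : F) (hα : α * (1 + ρ) = ρ) (hβ : α * β = 1)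
    (hρ0 : ρ ≠ 0) (hρ : 1 + ρ ≠ 0) (l m l' m' A B C D : F)
    (h : InS2 β ρ l m l' m')
    (e1 : A + l * (A + C) + m * (A + D) = 0) (e2 : l * B + m * (α * B) = 0)
    (e3 : l' * (A + C) + m' * (A + D) = 0) (e4 : B + l' * B + m' * (α * B) = 0) :
    TwoZero A B C D := by
  have hβρ : β * ρ = 1 + ρ := by linear_combination (1 + ρ) * hβ - β * hα
  obtain ⟨h0, h1, h3⟩ := h
  unfold TwoZero
  rcases h0 with ⟨rfl, rfl⟩ | ⟨rfl, rfl⟩ <;> rcases h1 with rfl | rfl | rfl | rfl <;>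
    rcases h3 with rfl | rfl
  all_goals (try simp only [zero_mul, zero_add, add_zero, mul_zero] at *)
  all_goals grind

end Cells
section Trades

variable {F : Type*} [Field F]

/-- first syndrome -/
def synd3 (t : F × F × F × F) : F × F × F × F := (t.1 + t.2.2.1, t.2.1, 1, 0)

/-- second syndrome -/
def synd4 (α : F) (t : F × F × F × F) : F × F × F × F := (t.1 + t.2.2.2, α * t.2.1, 0, 1)

/-- the cell of the trade of a word with given coefficients -/
def IsCell (α : F) (x y t : F × F × F × F) (l m l' m' : F) : Prop :=
  x = (t.1, 0, 0, 0) + l • synd3 t + m • synd4 α t ∧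
  y = (0, t.2.1, 0, 0) + l' • synd3 t + m' • synd4 α t

theorem cell_unique (h2 : (2 : F) = 0) (α β ρ : F) (hα : α * (1 + ρ) = ρ) (hβ : α * β = 1)
    (hρ0 : ρ ≠ 0) (hρ : 1 + ρ ≠ 0) (T : Set (F × F × F × F))
    (hT : ∀ t ∈ T, ∀ u ∈ T, TwoZero (t.1 - u.1) (t.2.1 - u.2.1) (t.2.2.1 - u.2.2.1)
      (t.2.2.2 - u.2.2.2) → t = u)
    (x y t u : F × F × F × F) (ht : t ∈ T) (hu : u ∈ T) (l m l' m' p q p' q' : F)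
    (h1 : IsCell α x y t l m l' m') (h3 : IsCell α x y u p q p' q')
    (hS : InS1 ρ l m l' m' ∨ InS2 β ρ l m l' m') :
    t = u ∧ l = p ∧ m = q ∧ l' = p' ∧ m' = q' := by
  obtain ⟨a, b, c, d⟩ := t
  obtain ⟨a₁, b₁, c₁, d₁⟩ := u
  obtain ⟨hx, hy⟩ := h1
  obtain ⟨hx1, hy1⟩ := h3
  rw [hx] at hx1
  rw [hy] at hy1
  simp [synd3, synd4] at hx1 hy1
  obtain ⟨i1, i2, rfl, rfl⟩ := hx1
  obtain ⟨j1, j2, rfl, rfl⟩ := hy1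
  refine ⟨hT _ ht _ hu ?_, rfl, rfl, rfl, rfl⟩
  rcases hS with hS | hS
  · refine key1 h2 α ρ hα hρ0 hρ l m l' m' _ _ _ _ hS ?_ ?_ ?_ ?_
    · linear_combination i1
    · linear_combination i2
    · linear_combination j1
    · linear_combination j2
  · refine key2 h2 α β ρ hα hβ hρ0 hρ l m l' m' _ _ _ _ hS ?_ ?_ ?_ ?_
    · linear_combination i1
    · linear_combination i2
    · linear_combination j1
    · linear_combination j2

/-- Being a cell with coefficients in `S` of the trade of `t`. -/
def CellRel (α : F) (T : Set (F × F × F × F)) (S : F → F → F → F → Prop) (x y t : F × F × F × F) :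
    Prop :=
  t ∈ T ∧ ∃ l m l' m', S l m l' m' ∧ IsCell α x y t l m l' m'

open Classical in
/-- The perturbation function: `w t` on the cells of the trade of `t`, zero elsewhere. -/
noncomputable def pert (α : F) (T : Set (F × F × F × F)) (S : F → F → F → F → Prop)
    (w : F × F × F × F → F × F × F × F) (x y : F × F × F × F) : F × F × F × F :=
  if h : ∃ t, CellRel α T S x y t then w h.choose else 0

theorem pert_zero (α : F) (T : Set (F × F × F × F)) (S : F → F → F → F → Prop)
    (w : F × F × F × F → F × F × F × F) (x y : F × F × F × F) (h : ¬ ∃ t, CellRel α T S x y t) :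
    pert α T S w x y = 0 := by
  unfold pert; rw [dif_neg h]

theorem pert_eq (α : F) (T : Set (F × F × F × F)) (S : F → F → F → F → Prop)
    (w : F × F × F × F → F × F × F × F)
    (hu : ∀ x y t u, CellRel α T S x y t → CellRel α T S x y u → t = u)
    (x y t : F × F × F × F) (h : CellRel α T S x y t) :
    pert α T S w x y = w t := by
  have h' : ∃ t, CellRel α T S x y t := ⟨t, h⟩
  unfold pert; rw [dif_pos h', hu x y _ t h'.choose_spec h]

/-- invariance of a perturbation under a shift by multiples of itself -/
theorem pert_shift (α : F) (T : Set (F × F × F × F)) (S : F → F → F → F → Prop)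
    (w : F × F × F × F → F × F × F × F)
    (hu : ∀ x y t u, CellRel α T S x y t → CellRel α T S x y u → t = u) (i j : F)
    (hs : ∀ x y t, CellRel α T S x y t → CellRel α T S (x + i • w t) (y + j • w t) t)
    (x y : F × F × F × F) :
    pert α T S w (x + i • pert α T S w x y) (y + j • pert α T S w x y) = pert α T S w x y := by
  by_cases h : ∃ t, CellRel α T S x y t
  · obtain ⟨t, ht⟩ := h
    rw [pert_eq α T S w hu x y t ht]
    exact pert_eq α T S w hu _ _ t (hs x y t ht)
  · rw [pert_zero α T S w x y h]
    simp [pert_zero α T S w x y h]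

theorem cell_shift (α : F) (x y t : F × F × F × F) (l m l' m' i i₁ j j₁ : F)
    (h : IsCell α x y t l m l' m') :
    IsCell α (x + (i • synd3 t + i₁ • synd4 α t)) (y + (j • synd3 t + j₁ • synd4 α t)) t
      (l + i) (m + i₁) (l' + j) (m' + j₁) := by
  obtain ⟨hx, hy⟩ := h
  constructor
  · rw [hx]; module
  · rw [hy]; module

theorem main_construction_s11 (h2 : (2 : F) = 0) (α β ρ : F) (hα : α * (1 + ρ) = ρ) (hβ : α * β = 1)
    (hρ0 : ρ ≠ 0) (hρ : 1 + ρ ≠ 0) (T : Set (F × F × F × F))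
    (hT : ∀ t ∈ T, ∀ u ∈ T, TwoZero (t.1 - u.1) (t.2.1 - u.2.1) (t.2.2.1 - u.2.2.1)
      (t.2.2.2 - u.2.2.2) → t = u) :
    ∃ M₁ M₂ : F × F × F × F → F × F × F × F → F × F × F × F,
    (∀ x y y', M₁ x y = M₁ x y' → y = y') ∧
    (∀ x x' y, M₁ x y = M₁ x' y → x = x') ∧
    (∀ x y y', M₂ x y = M₂ x y' → y = y') ∧
    (∀ x x' y, M₂ x y = M₂ x' y → x = x') ∧
    (∀ x y x' y', M₁ x y = M₁ x' y' → M₂ x y = M₂ x' y' → x = x' ∧ y = y') ∧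
    (∀ t ∈ T, M₁ (t.1, 0, 0, 0) (0, t.2.1, 0, 0) = (t.2.2.1, 0, 1, 0)) ∧
    (∀ t ∈ T, M₂ (t.1, 0, 0, 0) (0, t.2.1, 0, 0) = (t.2.2.2, 0, 0, 1)) := by
  have hβρ : β * ρ = 1 + ρ := by linear_combination (1 + ρ) * hβ - β * hα
  have U : ∀ x y t u, t ∈ T → u ∈ T → ∀ l m l' m' p q p' q',
      IsCell α x y t l m l' m' → IsCell α x y u p q p' q' →
      (InS1 ρ l m l' m' ∨ InS2 β ρ l m l' m') → t = u ∧ l = p ∧ m = q ∧ l' = p' ∧ m' = q' :=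
    fun x y t u ht hu l m l' m' p q p' q' h1 h3 hS =>
      cell_unique h2 α β ρ hα hβ hρ0 hρ T hT x y t u ht hu l m l' m' p q p' q' h1 h3 hS
  have u1 : ∀ x y t u, CellRel α T (InS1 ρ) x y t → CellRel α T (InS1 ρ) x y u → t = u := by
    rintro x y t u ⟨ht, l, m, l', m', hS, hc⟩ ⟨hu, p, q, p', q', -, hc'⟩
    exact (U x y t u ht hu _ _ _ _ _ _ _ _ hc hc' (Or.inl hS)).1
  have u2 : ∀ x y t u, CellRel α T (InS2 β ρ) x y t → CellRel α T (InS2 β ρ) x y u → t = u := by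
    rintro x y t u ⟨ht, l, m, l', m', hS, hc⟩ ⟨hu, p, q, p', q', -, hc'⟩
    exact (U x y t u ht hu _ _ _ _ _ _ _ _ hc hc' (Or.inr hS)).1
  have r1 : ∀ i j : F, (∀ l l', InS1 ρ l 0 l' 0 → InS1 ρ (l + i) 0 (l' + j) 0) →
      ∀ x y t, CellRel α T (InS1 ρ) x y t →
        CellRel α T (InS1 ρ) (x + i • synd3 t) (y + j • synd3 t) t := by
    rintro i j hij x y t ⟨ht, l, m, l', m', hS, hc⟩
    have hm : m = 0 := hS.1
    have hm' : m' = 0 := hS.2.1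
    subst hm hm'
    refine ⟨ht, _, _, _, _, hij _ _ hS, ?_⟩
    have := cell_shift α x y t l 0 l' 0 i 0 j 0 hc
    simpa using this
  have r2 : ∀ i j : F, (∀ l m l' m', InS2 β ρ l m l' m' → InS2 β ρ l (m + i) l' (m' + j)) →
      ∀ x y t, CellRel α T (InS2 β ρ) x y t →
        CellRel α T (InS2 β ρ) (x + i • synd4 α t) (y + j • synd4 α t) t := by
    rintro i j hij x y t ⟨ht, l, m, l', m', hS, hc⟩
    refine ⟨ht, _, _, _, _, hij _ _ _ _ hS, ?_⟩
    have := cell_shift α x y t l m l' m' 0 i 0 j hc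
    simpa using this
  have s1 : ∀ i j : F, (∀ l l', InS1 ρ l 0 l' 0 → InS1 ρ (l + i) 0 (l' + j) 0) →
      ∀ x y, pert α T (InS1 ρ) synd3 (x + i • pert α T (InS1 ρ) synd3 x y)
        (y + j • pert α T (InS1 ρ) synd3 x y) = pert α T (InS1 ρ) synd3 x y :=
    fun i j hij x y => pert_shift α T _ _ u1 i j (r1 i j hij) x y
  have s2 : ∀ i j : F, (∀ l m l' m', InS2 β ρ l m l' m' → InS2 β ρ l (m + i) l' (m' + j)) →
      ∀ x y, pert α T (InS2 β ρ) (synd4 α) (x + i • pert α T (InS2 β ρ) (synd4 α) x y)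
        (y + j • pert α T (InS2 β ρ) (synd4 α) x y) = pert α T (InS2 β ρ) (synd4 α) x y :=
    fun i j hij x y => pert_shift α T _ _ u2 i j (r2 i j hij) x y
  have P := perturbed h2 α β ρ hα hβ (pert α T (InS1 ρ) synd3)
    (pert α T (InS2 β ρ) (synd4 α)) ?_ ?_ ?_ ?_ ?_ ?_ ?_
  · obtain ⟨p1, p2, p3, p4, p5⟩ := P
    refine ⟨_, _, p1, p2, p3, p4, p5, ?_, ?_⟩
    · intro t ht
      have hR : CellRel α T (InS1 ρ) (t.1, 0, 0, 0) (0, t.2.1, 0, 0) t :=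
        ⟨ht, 0, 0, 0, 0, by simp [InS1], by simp [IsCell]⟩
      rw [pert_eq α T _ _ u1 _ _ t hR]
      ext <;> simp [synd3]
      · linear_combination t.1 * h2
      · linear_combination t.2.1 * h2
    · intro t ht
      have hR : CellRel α T (InS2 β ρ) (t.1, 0, 0, 0) (0, t.2.1, 0, 0) t :=
        ⟨ht, 0, 0, 0, 0, by simp [InS2], by simp [IsCell]⟩
      rw [pert_eq α T _ _ u2 _ _ t hR]
      ext <;> simp [synd4]
      · linear_combination t.1 * h2
      · linear_combination α * t.2.1 * h2
  · intro x y
    have := s1 0 1 (by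
      rintro l l' ⟨-, -, h, h'⟩
      refine ⟨rfl, rfl, ?_, ?_⟩ <;> grind) x y
    simpa using this
  · intro x y
    have := s1 1 0 (by
      rintro l l' ⟨-, -, h, h'⟩
      refine ⟨rfl, rfl, ?_, ?_⟩ <;> grind) x y
    simpa using this
  · intro x y
    exact s1 ρ (1 + ρ) (by
      rintro l l' ⟨-, -, h, h'⟩
      refine ⟨rfl, rfl, ?_, ?_⟩ <;> grind) x y
  · intro x y
    have := s2 0 β (by
      rintro l m l' m' ⟨h, h', h''⟩
      refine ⟨h, ?_, ?_⟩ <;> grind) x y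
    simpa using this
  · intro x y
    have := s2 1 0 (by
      rintro l m l' m' ⟨h, h', h''⟩
      refine ⟨h, ?_, ?_⟩ <;> grind) x y
    simpa using this
  · intro x y
    exact s2 (1 + ρ) (1 + ρ) (by
      rintro l m l' m' ⟨h, h', h''⟩
      refine ⟨h, ?_, ?_⟩ <;> grind) x y
  · intro x y
    by_cases h : ∃ t, CellRel α T (InS1 ρ) x y t
    · obtain ⟨t, ht⟩ := h
      rw [pert_eq α T _ _ u1 x y t ht]
      have hsh := r1 ρ (1 + ρ) (by
        rintro l l' ⟨-, -, h, h'⟩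
        refine ⟨rfl, rfl, ?_, ?_⟩ <;> grind) x y t ht
      obtain ⟨htT, l, m, l', m', hS, hc⟩ := ht
      have hm : m = 0 := hS.1
      have hm' : m' = 0 := hS.2.1
      subst hm hm'
      have hc2 : IsCell α (x + ρ • synd3 t) (y + (1 + ρ) • synd3 t) t (l + ρ) 0 (l' + (1 + ρ)) 0 := by
        simpa using cell_shift α x y t l 0 l' 0 ρ 0 (1 + ρ) 0 hc
      by_cases hin : InS2 β ρ l 0 l' 0
      · have hin2 : InS2 β ρ (l + ρ) 0 (l' + (1 + ρ)) 0 := by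
          obtain ⟨h, -, -⟩ := hin
          refine ⟨?_, ?_, ?_⟩ <;> grind
        rw [pert_eq α T _ (synd4 α) u2 x y t ⟨htT, _, _, _, _, hin, hc⟩,
          pert_eq α T _ (synd4 α) u2 _ _ t ⟨htT, _, _, _, _, hin2, hc2⟩]
      · rw [pert_zero α T _ (synd4 α) x y, pert_zero α T _ (synd4 α)]
        · rintro ⟨u, hu, p, q, p', q', hSu, hcu⟩
          obtain ⟨rfl, rfl, rfl, rfl, rfl⟩ := U _ _ u t hu htT _ _ _ _ _ _ _ _ hcu hc2 (Or.inr hSu)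
          apply hin
          obtain ⟨h, -, -⟩ := hSu
          refine ⟨?_, ?_, ?_⟩ <;> grind
        · rintro ⟨u, hu, p, q, p', q', hSu, hcu⟩
          obtain ⟨rfl, rfl, rfl, rfl, rfl⟩ := U _ _ u t hu htT _ _ _ _ _ _ _ _ hcu hc (Or.inr hSu)
          exact hin hSu
    · rw [pert_zero α T _ _ x y h]; simp

end Trades
section Final

/-- the words `(a, b, c, d)` of a pair of orthogonal partial latin squares -/
def InWord (P Q : Set (ℕ × ℕ × ℕ)) (a b c d : ℕ) : Prop := (a, b, c) ∈ P ∧ (a, b, d) ∈ Q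

theorem word_unique (n : ℕ) (P Q : Set (ℕ × ℕ × ℕ))
    (hP : IsPLS n P) (hQ : IsPLS n Q) (hPQ : OrthPLS P Q) (a b c d a' b' c' d' : ℕ)
    (h : InWord P Q a b c d) (h' : InWord P Q a' b' c' d')
    (hh : (a = a' ∧ b = b') ∨ (a = a' ∧ c = c') ∨ (a = a' ∧ d = d') ∨ (b = b' ∧ c = c') ∨
      (b = b' ∧ d = d') ∨ (c = c' ∧ d = d')) :
    a = a' ∧ b = b' ∧ c = c' ∧ d = d' := by
  obtain ⟨p, q⟩ := h
  obtain ⟨p', q'⟩ := h'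
  obtain ⟨-, P1, P2, P3⟩ := hP
  obtain ⟨-, Q1, Q2, Q3⟩ := hQ
  have key : a = a' → b = b' → a = a' ∧ b = b' ∧ c = c' ∧ d = d' := by
    rintro rfl rfl
    exact ⟨rfl, rfl, P1 _ _ _ _ p p', Q1 _ _ _ _ q q'⟩
  rcases hh with ⟨h1, h3⟩ | ⟨h1, h3⟩ | ⟨h1, h3⟩ | ⟨h1, h3⟩ | ⟨h1, h3⟩ | ⟨h1, h3⟩
  · exact key h1 h3
  · subst h1 h3; exact key rfl (P2 _ _ _ _ p p')
  · subst h1 h3; exact key rfl (Q2 _ _ _ _ q q')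
  · subst h1 h3; exact key (P3 _ _ _ _ p p') rfl
  · subst h1 h3; exact key (Q3 _ _ _ _ q q') rfl
  · subst h1 h3
    by_cases hne : ((a, b) : ℕ × ℕ) = (a', b')
    · exact key (congrArg Prod.fst hne) (congrArg Prod.snd hne)
    · exact absurd rfl (hPQ.2 _ _ _ _ _ _ _ hne p p' q q')

theorem word_bound (n : ℕ) (P Q : Set (ℕ × ℕ × ℕ))
    (hP : IsPLS n P) (hQ : IsPLS n Q) (a b c d : ℕ)
    (h : InWord P Q a b c d) : a < n ∧ b < n ∧ c < n ∧ d < n := by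
  have h1 := hP.1 _ h.1
  have h3 := hQ.1 _ h.2
  exact ⟨h1.1, h1.2.1, h1.2.2, h3.2.2⟩

/-- It suffices to realize all the words. -/
theorem embeds_of_words {A : Type*} [Fintype A] (n N : ℕ) (hN : Fintype.card A = N)
    (P Q : Set (ℕ × ℕ × ℕ)) (hPQ : OrthPLS P Q) (M₁ M₂ : A → A → A) (f g h k : ℕ → A)
    (hM : (∀ x y y', M₁ x y = M₁ x y' → y = y') ∧
      (∀ x x' y, M₁ x y = M₁ x' y → x = x') ∧
      (∀ x y y', M₂ x y = M₂ x y' → y = y') ∧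
      (∀ x x' y, M₂ x y = M₂ x' y → x = x') ∧
      (∀ x y x' y', M₁ x y = M₁ x' y' → M₂ x y = M₂ x' y' → x = x' ∧ y = y'))
    (hf : ∀ x y, x < n → y < n → f x = f y → x = y)
    (hg : ∀ x y, x < n → y < n → g x = g y → x = y)
    (hh : ∀ x y, x < n → y < n → h x = h y → x = y)
    (hk : ∀ x y, x < n → y < n → k x = k y → x = y)
    (hw : ∀ a b c d, InWord P Q a b c d → M₁ (f a) (g b) = h c ∧ M₂ (f a) (g b) = k d) :
    EmbedsInOrthogonalPair n N P Q := by
  obtain ⟨m1, m2, m3, m4, m5⟩ := hM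
  refine embeds_of_type n N hN P Q M₁ M₂ f g h k m1 m2 m3 m4 m5 hf hg hh hk ?_ ?_
  · intro r c e he
    obtain ⟨d, hd⟩ := (hPQ.1 r c).1 ⟨e, he⟩
    exact (hw r c e d ⟨he, hd⟩).1
  · intro r c e he
    obtain ⟨d, hd⟩ := (hPQ.1 r c).2 ⟨e, he⟩
    exact (hw r c d e ⟨hd, he⟩).2

theorem exists_alpha (m : ℕ) (hm : 2 ≤ m) :
    (2 : GaloisField 2 m) = 0 ∧ ∃ α : GaloisField 2 m, α ≠ 0 ∧ 1 + α ≠ 0 := by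
  have h2 : (2 : GaloisField 2 m) = 0 := by
    have := CharP.cast_eq_zero (GaloisField 2 m) 2
    simpa using this
  refine ⟨h2, ?_⟩
  by_contra! hcon
  have hc : Nat.card (GaloisField 2 m) = 2 ^ m := GaloisField.card 2 m (by omega)
  have hsub : (Set.univ : Set (GaloisField 2 m)) ⊆ {0, 1} := by
    intro x _
    by_cases hx : x = 0
    · simp [hx]
    · have := hcon x hx
      right
      have : x = 1 := by linear_combination this - h2
      simpa using this
  have h3 := Set.ncard_le_ncard hsub (Set.toFinite _)
  rw [Set.ncard_univ, hc] at h3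
  have h4 : ({0, 1} : Set (GaloisField 2 m)).ncard ≤ 2 := (Set.ncard_insert_le _ _).trans (by simp)
  have h5 : 2 ^ 2 ≤ 2 ^ m := Nat.pow_le_pow_right (by norm_num) hm
  omega

theorem big_case (n m : ℕ) (hm : 2 ≤ m)
    (hnm : n ≤ 2 ^ m) (P Q : Set (ℕ × ℕ × ℕ))
    (hP : IsPLS n P) (hQ : IsPLS n Q) (hPQ : OrthPLS P Q) :
    EmbedsInOrthogonalPair n (2 ^ (4 * m)) P Q := by
  classical
  obtain ⟨h2, α, hα0, hα1⟩ := exists_alpha m hm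
  let _ : Fintype (GaloisField 2 m) := Fintype.ofFinite _
  have hc : Fintype.card (GaloisField 2 m) = 2 ^ m := by
    rw [← Nat.card_eq_fintype_card]; exact GaloisField.card 2 m (by omega)
  obtain ⟨ι, hι⟩ : ∃ ι : ℕ → GaloisField 2 m, ∀ x y, x < n → y < n → ι x = ι y → x = y := by
    let e := Fintype.equivFinOfCardEq hc
    refine ⟨fun x => if hx : x < 2 ^ m then e.symm ⟨x, hx⟩ else 0, ?_⟩
    intro x y hx hy hxy
    have hx' : x < 2 ^ m := by omega
    have hy' : y < 2 ^ m := by omega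
    simp only [hx', hy', dif_pos] at hxy
    have := e.symm.injective hxy
    simpa using this
  have hρ : 1 + α / (1 + α) = 1 / (1 + α) := by
    field_simp
    linear_combination α * h2
  let T : Set (GaloisField 2 m × GaloisField 2 m × GaloisField 2 m × GaloisField 2 m) :=
    {t | ∃ a b c d, InWord P Q a b c d ∧ t = (ι a, ι b, ι c, ι d)}
  obtain ⟨M₁, M₂, m1, m2, m3, m4, m5, m6, m7⟩ := main_construction_s11 h2 α α⁻¹ (α / (1 + α))
    (by rw [hρ]; field_simp) (mul_inv_cancel₀ hα0) (div_ne_zero hα0 hα1)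
    (by rw [hρ]; exact div_ne_zero one_ne_zero hα1) T (by
      rintro _ ⟨a, b, c, d, hw, rfl⟩ _ ⟨a', b', c', d', hw', rfl⟩ hz
      obtain ⟨i1, i2, i3, i4⟩ := word_bound n P Q hP hQ _ _ _ _ hw
      obtain ⟨j1, j2, j3, j4⟩ := word_bound n P Q hP hQ _ _ _ _ hw'
      obtain ⟨rfl, rfl, rfl, rfl⟩ := word_unique n P Q hP hQ hPQ _ _ _ _ _ _ _ _ hw hw' (by
        simp only [TwoZero, sub_eq_zero] at hz
        have e1 := hι a a' i1 j1
        have e2 := hι b b' i2 j2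
        have e3 := hι c c' i3 j3
        have e4 := hι d d' i4 j4
        tauto)
      rfl)
  refine embeds_of_words n _ ?_ P Q hPQ M₁ M₂ (fun a => (ι a, 0, 0, 0)) (fun a => (0, ι a, 0, 0))
    (fun a => (ι a, 0, 1, 0)) (fun a => (ι a, 0, 0, 1)) ⟨m1, m2, m3, m4, m5⟩ ?_ ?_ ?_ ?_ ?_
  · simp only [Fintype.card_prod, hc]; ring
  · intro x y hx hy h; exact hι x y hx hy (by simpa using h)
  · intro x y hx hy h; exact hι x y hx hy (by simpa using h)
  · intro x y hx hy h; exact hι x y hx hy (by simpa using h)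
  · intro x y hx hy h; exact hι x y hx hy (by simpa using h)
  · intro a b c d hw
    exact ⟨m6 (ι a, ι b, ι c, ι d) ⟨a, b, c, d, hw, rfl⟩,
      m7 (ι a, ι b, ι c, ι d) ⟨a, b, c, d, hw, rfl⟩⟩

/-- two agreements among four pairs -/
def TwoAgree (a b c d a' b' c' d' : ℕ) : Prop :=
  (a = a' ∧ b = b') ∨ (a = a' ∧ c = c') ∨ (a = a' ∧ d = d') ∨ (b = b' ∧ c = c') ∨
      (b = b' ∧ d = d') ∨ (c = c' ∧ d = d')

theorem two_agree_of_not (a b c d a₁ b₁ c₁ d₁ a₀ b₀ c₀ d₀ : ℕ)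
    (ha : a ≠ a₀ → a₁ ≠ a₀ → a = a₁) (hb : b ≠ b₀ → b₁ ≠ b₀ → b = b₁)
    (hc : c ≠ c₀ → c₁ ≠ c₀ → c = c₁) (hd : d ≠ d₀ → d₁ ≠ d₀ → d = d₁)
    (h0 : ¬ TwoAgree a b c d a₀ b₀ c₀ d₀) (h1 : ¬ TwoAgree a₁ b₁ c₁ d₁ a₀ b₀ c₀ d₀) :
    TwoAgree a b c d a₁ b₁ c₁ d₁ := by
  unfold TwoAgree at *
  by_cases xa : a = a₀ <;> by_cases xb : b = b₀ <;> by_cases xc : c = c₀ <;>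
    by_cases xd : d = d₀ <;> grind

set_option maxHeartbeats 1000000 in
theorem small_case (n : ℕ) (hn : n ≤ 2) (P Q : Set (ℕ × ℕ × ℕ))
    (hP : IsPLS n P) (hQ : IsPLS n Q) (hPQ : OrthPLS P Q) :
    EmbedsInOrthogonalPair n (2 ^ (4 * 1)) P Q := by
  classical
  obtain ⟨h2, α, hα0, hα1⟩ := exists_alpha 4 (by norm_num)
  let _ : Fintype (GaloisField 2 4) := Fintype.ofFinite _
  have hc : Fintype.card (GaloisField 2 4) = 2 ^ (4 * 1) := by
    rw [← Nat.card_eq_fintype_card]; exact GaloisField.card 2 4 (by omega)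
  have hρ : 1 + α / (1 + α) = 1 / (1 + α) := by
    field_simp
    linear_combination α * h2
  have hM := perturbed (V := GaloisField 2 4) h2 α α⁻¹ (α / (1 + α))
    (by rw [hρ]; field_simp) (mul_inv_cancel₀ hα0) (fun _ _ => 0) (fun _ _ => 0)
    (by simp) (by simp) (by simp) (by simp) (by simp) (by simp) (by simp)
  -- labels
  have hlab : ∀ (s : ℕ) (u : GaloisField 2 4), s < 2 → u ≠ 0 → ∀ x y, x < n → y < n →
      (if x = s then 0 else u) = (if y = s then 0 else u) → x = y := by
    intro s u hs hu x y hx hy h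
    split_ifs at h with h1 h3 h3
    · omega
    · exact absurd h.symm hu
    · exact absurd h hu
    · omega
  suffices H : ∃ a₀ b₀ c₀ d₀ : ℕ, ∃ u v w z : GaloisField 2 4, a₀ < 2 ∧ b₀ < 2 ∧ c₀ < 2 ∧ d₀ < 2 ∧
      u ≠ 0 ∧ v ≠ 0 ∧ w ≠ 0 ∧ z ≠ 0 ∧ ∀ a b c d, InWord P Q a b c d →
      (if a = a₀ then 0 else u) + (if b = b₀ then 0 else v) = (if c = c₀ then 0 else w) ∧
      (if a = a₀ then 0 else u) + α * (if b = b₀ then 0 else v) = (if d = d₀ then 0 else z) by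
    obtain ⟨a₀, b₀, c₀, d₀, u, v, w, z, ha, hb, hc0, hd, hu, hv, hw, hz, H⟩ := H
    refine embeds_of_words n _ hc P Q hPQ _ _ (fun x => if x = a₀ then 0 else u)
      (fun x => if x = b₀ then 0 else v) (fun x => if x = c₀ then 0 else w)
      (fun x => if x = d₀ then 0 else z) hM (hlab a₀ u ha hu) (hlab b₀ v hb hv)
      (hlab c₀ w hc0 hw) (hlab d₀ z hd hz) ?_
    intro a b c d hwd
    simpa using H a b c d hwd
  by_cases hex : ∃ a b c d, InWord P Q a b c d
  swap
  · refine ⟨0, 0, 0, 0, 1, 1, 1, 1, by norm_num, by norm_num, by norm_num, by norm_num,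
      one_ne_zero, one_ne_zero, one_ne_zero, one_ne_zero, ?_⟩
    intro a b c d hw
    exact absurd ⟨a, b, c, d, hw⟩ hex
  obtain ⟨a₀, b₀, c₀, d₀, h0⟩ := hex
  obtain ⟨i1, i2, i3, i4⟩ := word_bound n P Q hP hQ _ _ _ _ h0
  -- the three possible kinds of words
  have hstar : ∀ u v w z : GaloisField 2 4, u ≠ 0 → v ≠ 0 → w ≠ 0 → z ≠ 0 →
      (∀ a b c d, InWord P Q a b c d → ¬ (a = a₀ ∧ b = b₀ ∧ c = c₀ ∧ d = d₀) →
      (if a = a₀ then 0 else u) + (if b = b₀ then 0 else v) = (if c = c₀ then 0 else w) ∧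
      (if a = a₀ then 0 else u) + α * (if b = b₀ then 0 else v) = (if d = d₀ then 0 else z)) →
      ∃ a₀ b₀ c₀ d₀ : ℕ, ∃ u v w z : GaloisField 2 4, a₀ < 2 ∧ b₀ < 2 ∧ c₀ < 2 ∧ d₀ < 2 ∧
      u ≠ 0 ∧ v ≠ 0 ∧ w ≠ 0 ∧ z ≠ 0 ∧ ∀ a b c d, InWord P Q a b c d →
      (if a = a₀ then 0 else u) + (if b = b₀ then 0 else v) = (if c = c₀ then 0 else w) ∧
      (if a = a₀ then 0 else u) + α * (if b = b₀ then 0 else v) = (if d = d₀ then 0 else z) := by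
    intro u v w z hu hv hw hz H
    refine ⟨a₀, b₀, c₀, d₀, u, v, w, z, by omega, by omega, by omega, by omega, hu, hv, hw, hz, ?_⟩
    intro a b c d hwd
    by_cases he : a = a₀ ∧ b = b₀ ∧ c = c₀ ∧ d = d₀
    · obtain ⟨rfl, rfl, rfl, rfl⟩ := he
      simp
    · exact H a b c d hwd he
  by_cases hex1 : ∃ a b c d, InWord P Q a b c d ∧ ¬ (a = a₀ ∧ b = b₀ ∧ c = c₀ ∧ d = d₀)
  swap
  · refine hstar 1 1 1 1 one_ne_zero one_ne_zero one_ne_zero one_ne_zero ?_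
    intro a b c d hw hne
    exact absurd ⟨a, b, c, d, hw, hne⟩ hex1
  obtain ⟨a₁, b₁, c₁, d₁, h1, hne1⟩ := hex1
  obtain ⟨j1, j2, j3, j4⟩ := word_bound n P Q hP hQ _ _ _ _ h1
  have q1 : ¬ TwoAgree a₁ b₁ c₁ d₁ a₀ b₀ c₀ d₀ :=
    fun q => hne1 (word_unique n P Q hP hQ hPQ _ _ _ _ _ _ _ _ h1 h0 q)
  have huniq : ∀ a b c d, InWord P Q a b c d → ¬ (a = a₀ ∧ b = b₀ ∧ c = c₀ ∧ d = d₀) →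
      a = a₁ ∧ b = b₁ ∧ c = c₁ ∧ d = d₁ := by
    intro a b c d hw hne
    obtain ⟨k1, k2, k3, k4⟩ := word_bound n P Q hP hQ _ _ _ _ hw
    have q0 : ¬ TwoAgree a b c d a₀ b₀ c₀ d₀ := fun q => hne (word_unique n P Q hP hQ hPQ _ _ _ _ _ _ _ _ hw h0 q)
    apply word_unique n P Q hP hQ hPQ _ _ _ _ _ _ _ _ hw h1
    exact two_agree_of_not a b c d a₁ b₁ c₁ d₁ a₀ b₀ c₀ d₀ (by clear hne hne1; omega)
      (by clear hne hne1; omega) (by clear hne hne1; omega) (by clear hne hne1; omega) q0 q1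
  have hstar' : ∀ u v w z : GaloisField 2 4, u ≠ 0 → v ≠ 0 → w ≠ 0 → z ≠ 0 →
      ((if a₁ = a₀ then 0 else u) + (if b₁ = b₀ then 0 else v) = (if c₁ = c₀ then 0 else w) ∧
      (if a₁ = a₀ then 0 else u) + α * (if b₁ = b₀ then 0 else v) = (if d₁ = d₀ then 0 else z)) →
      _ := fun u v w z hu hv hw hz H => hstar u v w z hu hv hw hz (by
        intro a b c d hwd hne
        obtain ⟨rfl, rfl, rfl, rfl⟩ := huniq a b c d hwd hne
        exact H)
  have o : (1 : GaloisField 2 4) ≠ 0 := one_ne_zero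
  by_cases ea : a₁ = a₀
  · have eb : b₁ ≠ b₀ := fun h => q1 (by unfold TwoAgree; simp [ea, h])
    have ec : c₁ ≠ c₀ := fun h => q1 (by unfold TwoAgree; simp [ea, h])
    have ed : d₁ ≠ d₀ := fun h => q1 (by unfold TwoAgree; simp [ea, h])
    refine hstar' 1 1 1 α o o o hα0 ?_
    simp [ea, eb, ec, ed]
  by_cases eb : b₁ = b₀
  · have ec : c₁ ≠ c₀ := fun h => q1 (by unfold TwoAgree; simp [eb, h])
    have ed : d₁ ≠ d₀ := fun h => q1 (by unfold TwoAgree; simp [eb, h])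
    refine hstar' 1 1 1 1 o o o o ?_
    simp [ea, eb, ec, ed]
  by_cases ec : c₁ = c₀
  · have ed : d₁ ≠ d₀ := fun h => q1 (by unfold TwoAgree; simp [ec, h])
    refine hstar' 1 1 1 (1 + α) o o o hα1 ?_
    simp only [ea, eb, ec, ed, if_true, if_false]
    exact ⟨by linear_combination h2, by ring⟩
  by_cases ed : d₁ = d₀
  · refine hstar' α 1 (1 + α) 1 hα0 o hα1 o ?_
    simp only [ea, eb, ec, ed, if_true, if_false]
    exact ⟨by ring, by linear_combination α * h2⟩
  · refine hstar' 1 α (1 + α) ((1 + α) * (1 + α)) o hα0 hα1 (mul_ne_zero hα1 hα1) ?_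
    simp only [ea, eb, ec, ed, if_false]
    exact ⟨trivial, by linear_combination -α * h2⟩

end Final

/-- Theorem 4.2 (general embedding): a pair of orthogonal partial latin squares of
order `n ≤ 2^m` embeds in a pair of orthogonal latin squares of order `2^(4m)`. -/
theorem general_embedding (n m : ℕ) (hn : 0 < n) (hm : 0 < m)
    (hnm : n ≤ 2 ^ m) (P Q : Set (ℕ × ℕ × ℕ))
    (hP : IsPLS n P) (hQ : IsPLS n Q) (hPQ : OrthPLS P Q) :
    EmbedsInOrthogonalPair n (2 ^ (4 * m)) P Q := by
  rcases Nat.lt_or_ge m 2 with h | h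
  · have hm1 : m = 1 := by omega
    subst hm1
    exact small_case n (by simpa using hnm) P Q hP hQ hPQ
  · exact big_case n m h hnm P Q hP hQ hPQ
end

section
/- Let P and Q be a pair of orthogonal partial latin squares of order n ≥ 1 on the set of symbols [n]. Then there exists an integer t with t ≤ 16n^4 such that P and Q can be embedded in a pair of orthogonal latin squares of order t. -/
/-- Translating a linear pair of orthogonal latin squares by offsets that are locally
constant along suitable submodules keeps it a pair of orthogonal latin squares. -/
theorem offset_latin {E V : Type*} [Field E] [AddCommGroup V] [Module E V] (α : E)
    (h0 : α ≠ 0) (h1 : α ≠ 1) (u v : V → V → V)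
    (hW : ∀ x y, ∃ W : Submodule E V, u x y ∈ W ∧ v x y ∈ W ∧
      ∀ w₁ ∈ W, ∀ w₂ ∈ W, u (x + w₁) (y + w₂) = u x y ∧ v (x + w₁) (y + w₂) = v x y) :
    (∀ x y₁ y₂, x + y₁ + u x y₁ = x + y₂ + u x y₂ → y₁ = y₂) ∧
    (∀ x₁ x₂ y, x₁ + y + u x₁ y = x₂ + y + u x₂ y → x₁ = x₂) ∧
    (∀ x y₁ y₂, x + α • y₁ + v x y₁ = x + α • y₂ + v x y₂ → y₁ = y₂) ∧
    (∀ x₁ x₂ y, x₁ + α • y + v x₁ y = x₂ + α • y + v x₂ y → x₁ = x₂) ∧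
    (∀ x₁ y₁ x₂ y₂, x₁ + y₁ + u x₁ y₁ = x₂ + y₂ + u x₂ y₂ →
      x₁ + α • y₁ + v x₁ y₁ = x₂ + α • y₂ + v x₂ y₂ → x₁ = x₂ ∧ y₁ = y₂) := by
  have h1' : (1 - α) ≠ 0 := sub_ne_zero.2 (Ne.symm h1)
  refine ⟨?_, ?_, ?_, ?_, ?_⟩
  · intro x y₁ y₂ h
    obtain ⟨W, hu, hv, hc⟩ := hW x y₁
    obtain ⟨W', hu', hv', hc'⟩ := hW x y₂
    have e1 := (hc 0 W.zero_mem _ hu).1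
    have e2 := (hc' 0 W'.zero_mem _ hu').1
    have e : y₁ + u x y₁ = y₂ + u x y₂ := by
      rw [add_assoc, add_assoc] at h
      exact add_left_cancel h
    rw [e, e2] at e1
    rw [e1] at e
    exact add_right_cancel e
  · intro x₁ x₂ y h
    obtain ⟨W, hu, hv, hc⟩ := hW x₁ y
    obtain ⟨W', hu', hv', hc'⟩ := hW x₂ y
    have e1 := (hc _ hu 0 W.zero_mem).1
    have e2 := (hc' _ hu' 0 W'.zero_mem).1
    have e : x₁ + u x₁ y = x₂ + u x₂ y := by
      rw [add_right_comm, add_right_comm x₂] at h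
      exact add_right_cancel h
    rw [e, e2] at e1
    rw [e1] at e
    exact add_right_cancel e
  · intro x y₁ y₂ h
    obtain ⟨W, hu, hv, hc⟩ := hW x y₁
    obtain ⟨W', hu', hv', hc'⟩ := hW x y₂
    have e1 := (hc 0 W.zero_mem _ (W.smul_mem α⁻¹ hv)).2
    have e2 := (hc' 0 W'.zero_mem _ (W'.smul_mem α⁻¹ hv')).2
    have e : y₁ + α⁻¹ • v x y₁ = y₂ + α⁻¹ • v x y₂ := by
      rw [add_assoc, add_assoc] at h
      have h := congrArg (fun z => α⁻¹ • z) (add_left_cancel h)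
      simpa [smul_add, smul_smul, h0] using h
    rw [e, e2] at e1
    rw [e1] at e
    exact add_right_cancel e
  · intro x₁ x₂ y h
    obtain ⟨W, hu, hv, hc⟩ := hW x₁ y
    obtain ⟨W', hu', hv', hc'⟩ := hW x₂ y
    have e1 := (hc _ hv 0 W.zero_mem).2
    have e2 := (hc' _ hv' 0 W'.zero_mem).2
    have e : x₁ + v x₁ y = x₂ + v x₂ y := by
      rw [add_right_comm, add_right_comm x₂] at h
      exact add_right_cancel h
    rw [e, e2] at e1
    rw [e1] at e
    exact add_right_cancel e
  · intro x₁ y₁ x₂ y₂ h h'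
    obtain ⟨W, hu, hv, hc⟩ := hW x₁ y₁
    obtain ⟨W', hu', hv', hc'⟩ := hW x₂ y₂
    have k1 : (1 - α)⁻¹ • (u x₁ y₁ - v x₁ y₁) ∈ W := W.smul_mem _ (W.sub_mem hu hv)
    have k2 : (1 - α)⁻¹ • (u x₂ y₂ - v x₂ y₂) ∈ W' := W'.smul_mem _ (W'.sub_mem hu' hv')
    have e1 := hc _ (W.sub_mem hu k1) _ k1
    have e2 := hc' _ (W'.sub_mem hu' k2) _ k2
    have ey : y₁ + (1 - α)⁻¹ • (u x₁ y₁ - v x₁ y₁)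
        = y₂ + (1 - α)⁻¹ • (u x₂ y₂ - v x₂ y₂) := by
      have hh : (1 - α) • y₁ + (u x₁ y₁ - v x₁ y₁) = (1 - α) • y₂ + (u x₂ y₂ - v x₂ y₂) := by
        linear_combination (norm := module) h - h'
      have hh := congrArg (fun z => (1 - α)⁻¹ • z) hh
      simpa only [smul_add, smul_smul, inv_mul_cancel₀ h1', one_smul] using hh
    have ex : x₁ + (u x₁ y₁ - (1 - α)⁻¹ • (u x₁ y₁ - v x₁ y₁))
        = x₂ + (u x₂ y₂ - (1 - α)⁻¹ • (u x₂ y₂ - v x₂ y₂)) := by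
      linear_combination (norm := module) h - ey
    rw [ex, ey, e2.1, e2.2] at e1
    rw [← e1.1, ← e1.2] at ex ey
    exact ⟨add_right_cancel ex, add_right_cancel ey⟩

/-- The linear algebra behind disjointness of the trades. -/
theorem diff_zero {E A : Type*} [Field E] [AddCommGroup A] [Module E A] (α : E)
    (ρ γ σ δ : A) (a b a' b' : E)
    (h₁ : ρ = -(a • ρ) + b • (δ - ρ)) (h₂ : 0 = -(a • γ) + b • (δ - α • γ))
    (h₃ : 0 = a • σ + b • δ)
    (k₁ : 0 = -(a' • ρ) + b' • (δ - ρ)) (k₂ : γ = -(a' • γ) + b' • (δ - α • γ))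
    (k₃ : 0 = a' • σ + b' • δ)
    (hrp : ρ = 0 → σ = 0 → γ = 0) (hrt : ρ = 0 → δ = 0 → γ = 0)
    (hcp : γ = 0 → σ = 0 → ρ = 0) (hct : γ = 0 → δ = 0 → ρ = 0)
    (hpt : σ = 0 → δ = 0 → ρ = 0 ∧ γ = 0) : ρ = 0 ∧ γ = 0 := by
  by_cases hρ : ρ = 0
  · refine ⟨hρ, ?_⟩
    by_contra hγ
    have hσ : σ ≠ 0 := fun h => hγ (hrp hρ h)
    have hδ : δ ≠ 0 := fun h => hγ (hrt hρ h)
    have q₁ : b' = 0 := by simpa [hρ, hδ] using k₁.symm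
    have q₂ : a' = 0 := by simpa [q₁, hσ] using k₃.symm
    exact hγ (by simpa [q₁, q₂] using k₂)
  exfalso
  by_cases hγ : γ = 0
  · have hδ : δ ≠ 0 := fun h => hρ (hct hγ h)
    have hσ : σ ≠ 0 := fun h => hρ (hcp hγ h)
    have q₁ : b = 0 := by simpa [hγ, hδ] using h₂.symm
    have q₂ : a = 0 := by simpa [q₁, hσ] using h₃.symm
    exact hρ (by simpa [q₁, q₂] using h₁)
  by_cases hσ : σ = 0
  · have hδ : δ ≠ 0 := fun h => hρ (hpt hσ h).1
    have q₁ : b = 0 := by simpa [hσ, hδ] using h₃.symm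
    have q₂ : a = 0 := by simpa [q₁, hγ] using h₂.symm
    exact hρ (by simpa [q₁, q₂] using h₁)
  have hb : b ≠ 0 := by
    intro hb
    have q₂ : a = 0 := by simpa [hb, hσ] using h₃.symm
    exact hρ (by simpa [hb, q₂] using h₁)
  have hb' : b' ≠ 0 := by
    intro hb
    have q₂ : a' = 0 := by simpa [hb, hσ] using k₃.symm
    exact hγ (by simpa [hb, q₂] using k₂)
  have e : (a * b' - a' * b) • σ = 0 := by
    linear_combination (norm := module) b • k₃ - b' • h₃
  have e' : a * b' - a' * b = 0 := (smul_eq_zero.1 e).resolve_right hσ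
  have f : (b' + b' * a - a' * b) • ρ = 0 := by
    linear_combination (norm := module) b' • h₁ - b • k₁
  have f' := (smul_eq_zero.1 f).resolve_right hρ
  apply hb'
  linear_combination f' - e'

section Construction
variable {E A : Type*} [Field E] [AddCommGroup A] [Module E A]

/-- First offset. -/
def offU (r c p : A) : E × E × A × A × A := (1, 0, -r, -c, p)

/-- Second offset. -/
def offV (α : E) (r c t : A) : E × E × A × A × A := (0, 1, t - r, t - α • c, t)

/-- Row points. -/
def ptR (r : A) : E × E × A × A × A := (0, 0, r, 0, 0)

/-- Column points. -/
def ptC (c : A) : E × E × A × A × A := (0, 0, 0, c, 0)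

/-- The submodule of a trade. -/
def trW (α : E) (r c p t : A) : Submodule E (E × E × A × A × A) :=
  Submodule.span E {offU r c p, offV α r c t}

/-- A block determines its cell. -/
theorem block_unique (α : E) (r c p t r' c' p' t' : A)
    (x y : E × E × A × A × A)
    (hx : x - ptR r ∈ trW α r c p t) (hy : y - ptC c ∈ trW α r c p t)
    (hx' : x - ptR r' ∈ trW α r' c' p' t') (hy' : y - ptC c' ∈ trW α r' c' p' t')
    (hrp : r = r' → p = p' → c = c') (hrt : r = r' → t = t' → c = c')
    (hcp : c = c' → p = p' → r = r') (hct : c = c' → t = t' → r = r')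
    (hpt : p = p' → t = t' → r = r' ∧ c = c') : r = r' ∧ c = c' := by
  obtain ⟨x1, x2, x3, x4, x5⟩ := x
  obtain ⟨y1, y2, y3, y4, y5⟩ := y
  simp only [trW, Submodule.mem_span_pair, offU, offV, ptR, ptC, Prod.smul_mk, Prod.mk_add_mk,
    Prod.mk_sub_mk, Prod.mk.injEq, smul_eq_mul, mul_one, mul_zero, add_zero, zero_add,
    sub_zero] at hx hy hx' hy'
  obtain ⟨a, b, rfl, rfl, h3, h4, h5⟩ := hx
  obtain ⟨a₂, b₂, rfl, rfl, h3', h4', h5'⟩ := hx'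
  obtain ⟨d, e, rfl, rfl, k3, k4, k5⟩ := hy
  obtain ⟨d₂, e₂, rfl, rfl, k3', k4', k5'⟩ := hy'
  have := diff_zero α (r - r') (c - c') (p - p') (t - t') (-a₂) (-b₂) (-d₂) (-e₂)
    (by linear_combination (norm := module) h3 - h3') (by linear_combination (norm := module) h4 - h4')
    (by linear_combination (norm := module) h5 - h5') (by linear_combination (norm := module) k3 - k3')
    (by linear_combination (norm := module) k4 - k4') (by linear_combination (norm := module) k5 - k5')
  simp only [sub_eq_zero] at this
  exact this hrp hrt hcp hct hpt

end Construction

/-- The construction over a field `E` and a vector space `A` with `n ≤ |A|`. -/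
theorem embeds_of_field (E A : Type) [Field E] [AddCommGroup A] [Module E A]
    [Finite E] [Finite A] (α : E) (h0 : α ≠ 0) (h1 : α ≠ 1) (n : ℕ) (hn : n ≤ Nat.card A)
    (P Q : Set (ℕ × ℕ × ℕ))
    (hP : IsPLS n P) (hQ : IsPLS n Q) (hPQ : OrthPLS P Q) :
    EmbedsInOrthogonalPair n (Nat.card E ^ 2 * Nat.card A ^ 3) P Q := by
  classical
  obtain ⟨i, hi⟩ : ∃ i : ℕ → A, ∀ x y, x < n → y < n → i x = i y → x = y := by
    let e := Finite.equivFin A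
    have : 0 < Nat.card A := Nat.card_pos
    refine ⟨fun x => e.symm ⟨x % Nat.card A, Nat.mod_lt _ this⟩, ?_⟩
    intro x y hx hy h
    have h := e.symm.injective h
    simpa [Nat.mod_eq_of_lt (hx.trans_le hn), Nat.mod_eq_of_lt (hy.trans_le hn)] using h
  obtain ⟨φ, ψ, hφ, hψφ, hφψ⟩ : ∃ (φ : E × E × A × A × A → ℕ) (ψ : ℕ → E × E × A × A × A),
      (∀ v, φ v < Nat.card E ^ 2 * Nat.card A ^ 3) ∧ (∀ v, ψ (φ v) = v) ∧
      (∀ k, k < Nat.card E ^ 2 * Nat.card A ^ 3 → φ (ψ k) = k) := by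
    have hc : Nat.card (E × E × A × A × A) = Nat.card E ^ 2 * Nat.card A ^ 3 := by
      simp only [Nat.card_prod]; ring
    rw [← hc]
    let e := Finite.equivFin (E × E × A × A × A)
    refine ⟨fun v => e v, fun k => if h : k < _ then e.symm ⟨k, h⟩ else 0,
      fun v => (e v).2, ?_, ?_⟩
    · intro v
      simp only [Fin.is_lt, dif_pos, Fin.eta, Equiv.symm_apply_apply]
    · intro k hk
      simp only [dif_pos hk, Equiv.apply_symm_apply]
  -- quadruples, blocks and offsets
  let good : ℕ × ℕ × ℕ × ℕ → E × E × A × A × A → E × E × A × A × A → Prop := fun q x y =>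
    ((q.1, q.2.1, q.2.2.1) ∈ P ∧ (q.1, q.2.1, q.2.2.2) ∈ Q) ∧
    x - ptR (i q.1) ∈ trW α (i q.1) (i q.2.1) (i q.2.2.1) (i q.2.2.2) ∧
    y - ptC (i q.2.1) ∈ trW α (i q.1) (i q.2.1) (i q.2.2.1) (i q.2.2.2)
  have huniq : ∀ q q' x y, good q x y → good q' x y → q = q' := by
    rintro ⟨r, c, p, t⟩ ⟨r', c', p', t'⟩ x y ⟨⟨hp, ht⟩, hx, hy⟩ ⟨⟨hp', ht'⟩, hx', hy'⟩
    dsimp only at *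
    obtain ⟨br, bc, bp⟩ := hP.1 _ hp
    obtain ⟨br', bc', bp'⟩ := hP.1 _ hp'
    obtain ⟨-, -, bt⟩ := hQ.1 _ ht
    obtain ⟨-, -, bt'⟩ := hQ.1 _ ht'
    dsimp only at *
    have key := block_unique α _ _ _ _ _ _ _ _ x y hx hy hx' hy'
      (fun h h' => by
        obtain rfl := hi _ _ br br' h
        obtain rfl := hi _ _ bp bp' h'
        rw [hP.2.2.1 _ _ _ _ hp hp'])
      (fun h h' => by
        obtain rfl := hi _ _ br br' h
        obtain rfl := hi _ _ bt bt' h'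
        rw [hQ.2.2.1 _ _ _ _ ht ht'])
      (fun h h' => by
        obtain rfl := hi _ _ bc bc' h
        obtain rfl := hi _ _ bp bp' h'
        rw [hP.2.2.2 _ _ _ _ hp hp'])
      (fun h h' => by
        obtain rfl := hi _ _ bc bc' h
        obtain rfl := hi _ _ bt bt' h'
        rw [hQ.2.2.2 _ _ _ _ ht ht'])
      (fun h h' => by
        obtain rfl := hi _ _ bp bp' h
        obtain rfl := hi _ _ bt bt' h'
        by_contra hne
        refine hPQ.2 r c r' c' p t t ?_ hp hp' ht ht' rfl
        intro heq
        simp only [Prod.mk.injEq] at heq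
        exact hne ⟨by rw [heq.1], by rw [heq.2]⟩)
    obtain rfl := hi _ _ br br' key.1
    obtain rfl := hi _ _ bc bc' key.2
    obtain rfl := hP.2.1 _ _ _ _ hp hp'
    obtain rfl := hQ.2.1 _ _ _ _ ht ht'
    rfl
  let u : E × E × A × A × A → E × E × A × A × A → E × E × A × A × A := fun x y =>
    if h : ∃ q, good q x y then
      offU (i h.choose.1) (i h.choose.2.1) (i h.choose.2.2.1) else 0
  let v : E × E × A × A × A → E × E × A × A × A → E × E × A × A × A := fun x y =>
    if h : ∃ q, good q x y then
      offV α (i h.choose.1) (i h.choose.2.1) (i h.choose.2.2.2) else 0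
  have hu : ∀ q x y, good q x y → u x y = offU (i q.1) (i q.2.1) (i q.2.2.1) := by
    intro q x y h
    have hex : ∃ q, good q x y := ⟨q, h⟩
    have : hex.choose = q := huniq _ _ _ _ hex.choose_spec h
    simp only [u, dif_pos hex, this]
  have hv : ∀ q x y, good q x y → v x y = offV α (i q.1) (i q.2.1) (i q.2.2.2) := by
    intro q x y h
    have hex : ∃ q, good q x y := ⟨q, h⟩
    have : hex.choose = q := huniq _ _ _ _ hex.choose_spec h
    simp only [v, dif_pos hex, this]
  obtain ⟨l1, l2, l3, l4, l5⟩ := offset_latin α h0 h1 u v (by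
    intro x y
    by_cases hex : ∃ q, good q x y
    · obtain ⟨q, hq⟩ := hex
      refine ⟨trW α (i q.1) (i q.2.1) (i q.2.2.1) (i q.2.2.2), ?_, ?_, ?_⟩
      · rw [hu q x y hq]
        exact Submodule.subset_span (by simp)
      · rw [hv q x y hq]
        exact Submodule.subset_span (by simp)
      · intro w₁ hw₁ w₂ hw₂
        have hq' : good q (x + w₁) (y + w₂) := by
          refine ⟨hq.1, ?_, ?_⟩
          · rw [add_sub_right_comm]
            exact Submodule.add_mem _ hq.2.1 hw₁
          · rw [add_sub_right_comm]
            exact Submodule.add_mem _ hq.2.2 hw₂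
        rw [hu q x y hq, hv q x y hq, hu q _ _ hq', hv q _ _ hq']
        exact ⟨rfl, rfl⟩
    · refine ⟨⊥, ?_, ?_, ?_⟩
      · simp only [u, dif_neg hex, Submodule.zero_mem]
      · simp only [v, dif_neg hex, Submodule.zero_mem]
      · intro w₁ hw₁ w₂ hw₂
        rw [Submodule.mem_bot] at hw₁ hw₂
        simp [hw₁, hw₂])
  have φinj : ∀ a b, φ a = φ b → a = b := fun a b h => by
    rw [← hψφ a, h, hψφ]
  have ψinj : ∀ a b, a < Nat.card E ^ 2 * Nat.card A ^ 3 →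
      b < Nat.card E ^ 2 * Nat.card A ^ 3 → ψ a = ψ b → a = b := fun a b ha hb h => by
    rw [← hφψ a ha, h, hφψ b hb]
  refine ⟨fun r c => φ (ψ r + ψ c + u (ψ r) (ψ c)),
    fun r c => φ (ψ r + α • ψ c + v (ψ r) (ψ c)),
    fun r => φ (ptR (i r)), fun c => φ (ptC (i c)), fun p => φ (1, 0, 0, 0, i p),
    fun t => φ (0, 1, i t, i t, i t), ⟨fun _ _ _ _ => hφ _, ?_, ?_⟩,
    ⟨fun _ _ _ _ => hφ _, ?_, ?_⟩, ?_, fun _ _ => hφ _, fun _ _ => hφ _, fun _ _ => hφ _,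
    fun _ _ => hφ _, ?_, ?_, ?_, ?_, ?_, ?_⟩
  · intro r c₁ c₂ hr hc₁ hc₂ h
    exact ψinj _ _ hc₁ hc₂ (l1 _ _ _ (φinj _ _ h))
  · intro r₁ r₂ c hr₁ hr₂ hc h
    exact ψinj _ _ hr₁ hr₂ (l2 _ _ _ (φinj _ _ h))
  · intro r c₁ c₂ hr hc₁ hc₂ h
    exact ψinj _ _ hc₁ hc₂ (l3 _ _ _ (φinj _ _ h))
  · intro r₁ r₂ c hr₁ hr₂ hc h
    exact ψinj _ _ hr₁ hr₂ (l4 _ _ _ (φinj _ _ h))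
  · intro r₁ c₁ r₂ c₂ hr₁ hc₁ hr₂ hc₂ hne h h'
    obtain ⟨e1, e2⟩ := l5 _ _ _ _ (φinj _ _ h) (φinj _ _ h')
    exact hne (by rw [ψinj _ _ hr₁ hr₂ e1, ψinj _ _ hc₁ hc₂ e2])
  · intro x y hx hy h
    have h := φinj _ _ h
    simp only [ptR, Prod.mk.injEq] at h
    exact hi _ _ hx hy h.2.2.1
  · intro x y hx hy h
    have h := φinj _ _ h
    simp only [ptC, Prod.mk.injEq] at h
    exact hi _ _ hx hy h.2.2.2.1
  · intro x y hx hy h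
    have h := φinj _ _ h
    simp only [Prod.mk.injEq] at h
    exact hi _ _ hx hy h.2.2.2.2
  · intro x y hx hy h
    have h := φinj _ _ h
    simp only [Prod.mk.injEq] at h
    exact hi _ _ hx hy h.2.2.2.2
  · intro r c p hp
    obtain ⟨t, ht⟩ := (hPQ.1 r c).1 ⟨p, hp⟩
    have hg : good (r, c, p, t) (ptR (i r)) (ptC (i c)) :=
      ⟨⟨hp, ht⟩, by simp, by simp⟩
    simp only [hψφ]
    rw [hu _ _ _ hg]
    simp [ptR, ptC, offU]
  · intro r c t ht
    obtain ⟨p, hp⟩ := (hPQ.1 r c).2 ⟨t, ht⟩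
    have hg : good (r, c, p, t) (ptR (i r)) (ptC (i c)) :=
      ⟨⟨hp, ht⟩, by simp, by simp⟩
    simp only [hψφ]
    rw [hv _ _ _ hg]
    simp [ptR, ptC, offV]

/-- The construction over the field with four elements. -/
theorem embeds_four (j n : ℕ) (hn : n ≤ 4 ^ j) (P Q : Set (ℕ × ℕ × ℕ))
    (hP : IsPLS n P) (hQ : IsPLS n Q) (hPQ : OrthPLS P Q) :
    EmbedsInOrthogonalPair n (4 ^ 2 * (4 ^ j) ^ 3) P Q := by
  have hc : Nat.card (GaloisField 2 2) = 4 := by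
    rw [GaloisField.card 2 2 (by norm_num)]; norm_num
  obtain ⟨α, h0, h1⟩ : ∃ α : GaloisField 2 2, α ≠ 0 ∧ α ≠ 1 := by
    by_contra! h
    have : (Set.univ : Set (GaloisField 2 2)) ⊆ {0, 1} := by
      intro x _
      by_cases hx : x = 0
      · simp [hx]
      · simp [h x hx]
    have h2 := Set.ncard_le_ncard this (Set.toFinite _)
    rw [Set.ncard_univ, hc, Set.ncard_pair zero_ne_one] at h2
    omega
  have hA : Nat.card (Fin j → GaloisField 2 2) = 4 ^ j := by
    simp [Nat.card_fun, hc]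
  have := embeds_of_field (GaloisField 2 2) (Fin j → GaloisField 2 2) α h0 h1 n
    (by rw [hA]; exact hn) P Q hP hQ hPQ
  rwa [hA, hc] at this

/-- The construction over the field with three elements. -/
theorem embeds_three (j n : ℕ) (hn : n ≤ 3 ^ j) (P Q : Set (ℕ × ℕ × ℕ))
    (hP : IsPLS n P) (hQ : IsPLS n Q) (hPQ : OrthPLS P Q) :
    EmbedsInOrthogonalPair n (3 ^ 2 * (3 ^ j) ^ 3) P Q := by
  have e0 : (2 : ZMod 3) ≠ 0 := by decide
  have e1 : (2 : ZMod 3) ≠ 1 := by decide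
  have : Fact (Nat.Prime 3) := ⟨Nat.prime_three⟩
  have hc : Nat.card (ZMod 3) = 3 := by simp
  have hA : Nat.card (Fin j → ZMod 3) = 3 ^ j := by
    simp
  have := embeds_of_field (ZMod 3) (Fin j → ZMod 3) 2 e0 e1 n
    (by rw [hA]; exact hn) P Q hP hQ hPQ
  rwa [hA, hc] at this

/-- A pair of orthogonal partial latin squares of order `n` embeds in a pair of
orthogonal latin squares of some order `t ≤ 16 n⁴`. -/
theorem embedding_at_most_sixteen_n_fourth (n : ℕ) (hn : 1 ≤ n)
    (P Q : Set (ℕ × ℕ × ℕ))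
    (hP : IsPLS n P) (hQ : IsPLS n Q) (hPQ : OrthPLS P Q) :
    ∃ t : ℕ, t ≤ 16 * n ^ 4 ∧ EmbedsInOrthogonalPair n t P Q := by
  by_cases h4 : n = 4
  · subst h4
    exact ⟨_, by norm_num, embeds_four 1 4 (by norm_num) P Q hP hQ hPQ⟩
  by_cases h10 : n = 10
  · subst h10
    exact ⟨_, by norm_num, embeds_four 2 10 (by norm_num) P Q hP hQ hPQ⟩
  by_cases h16 : n < 16
  · have hj : ∃ j, n ≤ 3 ^ j ∧ 3 ^ 2 * (3 ^ j) ^ 3 ≤ 16 * n ^ 4 := by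
      interval_cases n
      · exact ⟨0, by norm_num⟩
      · exact ⟨1, by norm_num⟩
      · exact ⟨1, by norm_num⟩
      · omega
      · exact ⟨2, by norm_num⟩
      · exact ⟨2, by norm_num⟩
      · exact ⟨2, by norm_num⟩
      · exact ⟨2, by norm_num⟩
      · exact ⟨2, by norm_num⟩
      · omega
      all_goals exact ⟨3, by norm_num⟩
    obtain ⟨j, hj, hb⟩ := hj
    exact ⟨_, hb, embeds_three j n hj P Q hP hQ hPQ⟩
  · push Not at h16
    have hcl : n ≤ 3 ^ Nat.clog 3 n := Nat.le_pow_clog (by norm_num) n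
    have hlt : 3 ^ (Nat.clog 3 n - 1) < n := Nat.pow_pred_clog_lt_self (by norm_num) (by omega)
    have hpos : 0 < Nat.clog 3 n := Nat.clog_pos (by norm_num) (by omega)
    refine ⟨_, ?_, embeds_three (Nat.clog 3 n) n hcl P Q hP hQ hPQ⟩
    have h3 : 3 ^ Nat.clog 3 n ≤ 3 * n := by
      obtain ⟨k, hk⟩ := Nat.exists_eq_succ_of_ne_zero hpos.ne'
      rw [hk] at hlt ⊢
      simp only [Nat.succ_eq_add_one, Nat.add_sub_cancel] at hlt
      rw [Nat.succ_eq_add_one, pow_succ]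
      omega
    calc 3 ^ 2 * (3 ^ Nat.clog 3 n) ^ 3 ≤ 3 ^ 2 * (3 * n) ^ 3 := by gcongr
      _ = 243 * n ^ 3 := by ring
      _ ≤ (16 * n) * n ^ 3 := by gcongr; omega
      _ = 16 * n ^ 4 := by ring
end
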